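/- arXiv:2303.14943 — 4 statements merged into one kernel-verified Lean document; each statement's English description precedes it below -/
import Mathlib

section
/- For pure states, genuine multipartite entanglement and genuine multipartite nonlocality are equivalent: a pure state |Φ⟩ on a finite-dimensional Hilbert space H_1 ⊗ ⋯ ⊗ H_n is not a product state across any nontrivial bipartition of {1,…,n} if and only if there exist local POVMs {M^{a_i}_{x_i}} such that the Born-rule distribution P(ā|x̄) = tr[(⊗_{i=1}^n M^{a_i}_{x_i}) |Φ⟩⟨Φ|] admits no biseparable no-signalling decomposition. -/
open scoped BigOperators ComplexOrder

/-! Framework: multipartite conditional distributions, no-signalling,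
biseparable no-signalling decompositions, quantum states and Born rule. -/

/-- Restriction of a dependent tuple to (the subtype attached to) a finset of parties. -/
def restrictTo {ι : Type} {A : ι → Type} (I : Finset ι) (a : ∀ i, A i) :
    ∀ i : {j // j ∈ I}, A i.1 :=
  fun i => a i.1

/-- `P` is a conditional probability distribution of outcomes given settings. -/
def IsCondDist {ι : Type} [Fintype ι] [DecidableEq ι] (A X : ι → Type) [∀ i, Fintype (A i)]
    (P : (∀ i, A i) → (∀ i, X i) → ℝ) : Prop :=
  (∀ a x, 0 ≤ P a x) ∧ ∀ x, ∑ a, P a x = 1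

/-- `P` is no-signalling: the marginal over any single party's outcome does not
depend on that party's setting (hence marginals over any subset of parties do not
depend on the settings of the complementary parties). -/
def NoSignalling {ι : Type} [Fintype ι] [DecidableEq ι] (A X : ι → Type)
    [∀ i, Fintype (A i)] (P : (∀ i, A i) → (∀ i, X i) → ℝ) : Prop :=
  IsCondDist A X P ∧
    ∀ (i : ι) (a : ∀ j, A j) (x x' : ∀ j, X j), (∀ j, j ≠ i → x j = x' j) →
      (∑ ai : A i, P (Function.update a i ai) x) =
        ∑ ai : A i, P (Function.update a i ai) x'

/-- `P` admits a biseparable no-signalling decomposition: a convex mixture, over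
nontrivial bipartitions `(I, Iᶜ)` of the parties, of products of a no-signalling
distribution on the parties in `I` and one on the parties in `Iᶜ`. -/
def BiseparableNS {ι : Type} [Fintype ι] [DecidableEq ι] (A X : ι → Type)
    [∀ i, Fintype (A i)] [∀ i, Fintype (X i)]
    (P : (∀ i, A i) → (∀ i, X i) → ℝ) : Prop :=
  ∃ (p : Finset ι → ℝ)
    (Q : ∀ I : Finset ι, (∀ i : {j // j ∈ I}, A i.1) → (∀ i : {j // j ∈ I}, X i.1) → ℝ)
    (R : ∀ I : Finset ι, (∀ i : {j // j ∈ Iᶜ}, A i.1) → (∀ i : {j // j ∈ Iᶜ}, X i.1) → ℝ),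
    (∀ I, 0 ≤ p I) ∧ (∑ I, p I = 1) ∧
    (∀ I, p I ≠ 0 → I ≠ ∅ ∧ I ≠ Finset.univ) ∧
    (∀ I, NoSignalling (fun i : {j // j ∈ I} => A i.1) (fun i : {j // j ∈ I} => X i.1) (Q I)) ∧
    (∀ I, NoSignalling (fun i : {j // j ∈ Iᶜ} => A i.1) (fun i : {j // j ∈ Iᶜ} => X i.1) (R I)) ∧
    ∀ a x, P a x =
      ∑ I : Finset ι, p I * Q I (restrictTo I a) (restrictTo I x) *
        R I (restrictTo Iᶜ a) (restrictTo Iᶜ x)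

/-- The tensor product of local operators, as a matrix on the product index type. -/
def tensorOp {ι : Type} [Fintype ι] (D : ι → Type)
    (M : ∀ i, Matrix (D i) (D i) ℂ) : Matrix (∀ i, D i) (∀ i, D i) ℂ :=
  Matrix.of fun v w => ∏ i, M i (v i) (w i)

/-- The projector `|ψ⟩⟨ψ|` onto a (pure) state vector. -/
def outerProj {ι : Type} (D : ι → Type) (ψ : (∀ i, D i) → ℂ) :
    Matrix (∀ i, D i) (∀ i, D i) ℂ :=
  Matrix.of fun v w => ψ v * (starRingEnd ℂ) (ψ w)

/-- A POVM: positive semidefinite operators summing to the identity. -/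
def IsPOVM {d : Type} [Fintype d] [DecidableEq d] {o : Type} [Fintype o]
    (M : o → Matrix d d ℂ) : Prop :=
  (∀ a, (M a).PosSemidef) ∧ (∑ a, M a) = 1

/-- The Born-rule distribution of outcomes `a` given settings `x`, for local POVMs
`M i x_i` performed on the state `ρ`. -/
noncomputable def BornDist {ι : Type} [Fintype ι] [DecidableEq ι] (D : ι → Type)
    [∀ i, Fintype (D i)] [∀ i, DecidableEq (D i)] (o s : ι → ℕ)
    (ρ : Matrix (∀ i, D i) (∀ i, D i) ℂ)
    (M : ∀ i, Fin (s i) → Fin (o i) → Matrix (D i) (D i) ℂ) :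
    (∀ i, Fin (o i)) → (∀ i, Fin (s i)) → ℝ :=
  fun a x => (Matrix.trace (tensorOp D (fun i => M i (x i) (a i)) * ρ)).re

/-- `ψ` is a product state across the bipartition `(I, Iᶜ)`. -/
def ProductAcross {ι : Type} [Fintype ι] [DecidableEq ι] (D : ι → Type) (I : Finset ι)
    (ψ : (∀ i, D i) → ℂ) : Prop :=
  ∃ (φ : (∀ i : {j // j ∈ I}, D i.1) → ℂ) (χ : (∀ i : {j // j ∈ Iᶜ}, D i.1) → ℂ),
    ∀ v, ψ v = φ (restrictTo I v) * χ (restrictTo Iᶜ v)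

/-- Genuine multipartite entanglement of a pure state: it is not a product state
across any nontrivial bipartition of the parties. -/
def GenuinelyEntangled {ι : Type} [Fintype ι] [DecidableEq ι] (D : ι → Type) (ψ : (∀ i, D i) → ℂ) : Prop :=
  ∀ I : Finset ι, I ≠ ∅ → I ≠ Finset.univ → ¬ ProductAcross D I ψ



/-! ### Multilinear forms as polynomials -/

section MultilinearForm

set_option linter.unusedSectionVars false

variable {ι : Type} [Fintype ι] [DecidableEq ι] {D : ι → Type} [∀ i, Fintype (D i)]
  [∀ i, DecidableEq (D i)]

/-- The multilinear form with coefficient tensor `c`. -/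
def multiform (c : (∀ i, D i) → ℂ) (z : ∀ i, D i → ℂ) : ℂ :=
  ∑ v, c v * ∏ i, z i (v i)

/-- The multilinear form with coefficient tensor `c`, as a polynomial. -/
noncomputable def multiPoly (c : (∀ i, D i) → ℂ) : MvPolynomial (Σ i, D i) ℂ :=
  ∑ v, MvPolynomial.C (c v) * ∏ i, MvPolynomial.X ⟨i, v i⟩

lemma eval_multiPoly (c : (∀ i, D i) → ℂ) (z : (Σ i, D i) → ℂ) :
    MvPolynomial.eval z (multiPoly c) = multiform c (fun i k => z ⟨i, k⟩) := by
  simp [multiPoly, multiform]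

lemma multiform_single (c : (∀ i, D i) → ℂ) (v : ∀ i, D i) :
    multiform c (fun i => Pi.single (v i) 1) = c v := by
  unfold multiform
  rw [Finset.sum_eq_single v]
  · simp
  · intro w _ hw
    obtain ⟨i, hi⟩ := Function.ne_iff.mp hw
    rw [Finset.prod_eq_zero (Finset.mem_univ i) (by simp [hi]), mul_zero]
  · simp

lemma multiPoly_ne_zero {c : (∀ i, D i) → ℂ} (hc : c ≠ 0) : multiPoly c ≠ 0 := by
  intro h
  refine hc (funext fun v => ?_)
  have := eval_multiPoly c (fun s => (Pi.single (v s.1) 1 : D s.1 → ℂ) s.2)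
  rw [h, map_zero] at this
  exact (this.trans (multiform_single c v)).symm

/-- Multiply the variables of block `i` by a formal parameter. -/
noncomputable def blockScale (i : ι) :
    MvPolynomial (Σ i, D i) ℂ →ₐ[ℂ] Polynomial (MvPolynomial (Σ i, D i) ℂ) :=
  MvPolynomial.aeval fun s =>
    Polynomial.C (MvPolynomial.X s) * (if s.1 = i then Polynomial.X else 1)

lemma eval_blockScale (i : ι) (t : ℂ) (z : (Σ i, D i) → ℂ) (p : MvPolynomial (Σ i, D i) ℂ) :
    MvPolynomial.eval z ((blockScale i p).eval (MvPolynomial.C t)) =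
      MvPolynomial.eval (fun s => z s * (if s.1 = i then t else 1)) p := by
  induction p using MvPolynomial.induction_on with
  | C a =>
    have : blockScale i (MvPolynomial.C a : MvPolynomial (Σ i, D i) ℂ) =
        Polynomial.C (MvPolynomial.C a) := by
      rw [blockScale, MvPolynomial.aeval_C]; rfl
    simp [this]
  | add p q hp hq => rw [map_add, Polynomial.eval_add, map_add, hp, hq, map_add]
  | mul_X p s hp =>
    rw [map_mul (blockScale i), Polynomial.eval_mul, map_mul (MvPolynomial.eval z), hp,
      map_mul (MvPolynomial.eval _) p, MvPolynomial.eval_X, blockScale, MvPolynomial.aeval_X]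
    congr 1
    split_ifs <;> simp

lemma blockScale_multiPoly (i : ι) (c : (∀ i, D i) → ℂ) :
    blockScale i (multiPoly c) = Polynomial.C (multiPoly c) * Polynomial.X := by
  simp only [multiPoly, map_sum, map_mul, map_prod, Finset.sum_mul]
  refine Finset.sum_congr rfl fun v _ => ?_
  have hC : blockScale i (MvPolynomial.C (c v) : MvPolynomial (Σ i, D i) ℂ) =
      Polynomial.C (MvPolynomial.C (c v)) := by
    rw [blockScale, MvPolynomial.aeval_C]; rfl
  rw [hC, mul_assoc]
  congr 1
  simp only [blockScale, MvPolynomial.aeval_X, Finset.prod_mul_distrib]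
  simp

lemma eval_eq_of_natDegree_blockScale {i : ι} {p : MvPolynomial (Σ i, D i) ℂ}
    (h : (blockScale i p).natDegree = 0) (z : (Σ i, D i) → ℂ) (t : ℂ) :
    MvPolynomial.eval (fun s => z s * (if s.1 = i then t else 1)) p = MvPolynomial.eval z p := by
  have h1 := eval_blockScale i 1 z p
  rw [← eval_blockScale]
  rw [Polynomial.eq_C_of_natDegree_eq_zero h, Polynomial.eval_C] at h1 ⊢
  simpa using h1

lemma natDegree_blockScale_of_mul {c : (∀ i, D i) → ℂ} (hc : c ≠ 0)
    {p q : MvPolynomial (Σ i, D i) ℂ} (h : multiPoly c = p * q) (i : ι) :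
    (blockScale i p).natDegree = 0 ∨ (blockScale i q).natDegree = 0 := by
  have hf := multiPoly_ne_zero hc
  have hmul := blockScale_multiPoly i c
  rw [h, map_mul] at hmul
  rw [h] at hf
  have hne : blockScale i p * blockScale i q ≠ 0 := by
    rw [hmul]
    exact mul_ne_zero (by simpa using hf) Polynomial.X_ne_zero
  have hdeg := congrArg Polynomial.natDegree hmul
  rw [Polynomial.natDegree_mul (left_ne_zero_of_mul hne) (right_ne_zero_of_mul hne),
    Polynomial.natDegree_C_mul_X _ hf] at hdeg
  omega

/-- A polynomial that does not depend on the blocks of `s` is unchanged by zeroing them. -/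
lemma eval_eq_of_forall_natDegree_blockScale {p : MvPolynomial (Σ i, D i) ℂ} (s : Finset ι)
    (h : ∀ i ∈ s, (blockScale i p).natDegree = 0) (z : (Σ i, D i) → ℂ) :
    MvPolynomial.eval (fun x => if x.1 ∈ s then 0 else z x) p = MvPolynomial.eval z p := by
  induction s using Finset.induction_on with
  | empty => simp
  | insert i s hi ih =>
    clear hi
    rw [← ih fun j hj => h j (Finset.mem_insert_of_mem hj),
      ← eval_eq_of_natDegree_blockScale (h i (Finset.mem_insert_self i s))
        (fun x => if x.1 ∈ s then 0 else z x) 0]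
    congr 2
    funext x
    by_cases h1 : x.1 = i
    · simp [h1]
    · simp [h1]

lemma isUnit_of_forall_natDegree_blockScale {p : MvPolynomial (Σ i, D i) ℂ} (hp : p ≠ 0)
    (h : ∀ i, (blockScale i p).natDegree = 0) : IsUnit p := by
  have hC : p = MvPolynomial.C (MvPolynomial.eval 0 p) := by
    refine MvPolynomial.funext fun z => ?_
    rw [← eval_eq_of_forall_natDegree_blockScale Finset.univ (fun i _ => h i) z]
    simp only [Finset.mem_univ, if_true, MvPolynomial.eval_C]
    rfl
  rw [hC] at hp ⊢
  exact (isUnit_iff_ne_zero.mpr fun h0 => hp (by rw [h0, map_zero])).map MvPolynomial.C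

lemma productAcross_of_mul {c : (∀ i, D i) → ℂ} {p q : MvPolynomial (Σ i, D i) ℂ}
    (h : multiPoly c = p * q) (I : Finset ι)
    (hp : ∀ i ∈ Iᶜ, (blockScale i p).natDegree = 0)
    (hq : ∀ i ∈ I, (blockScale i q).natDegree = 0) : ProductAcross D I c := by
  refine ⟨fun w => MvPolynomial.eval
      (fun x => if hx : x.1 ∈ I then (Pi.single (w ⟨x.1, hx⟩) 1 : D x.1 → ℂ) x.2 else 0) p,
    fun w => MvPolynomial.eval
      (fun x => if hx : x.1 ∈ Iᶜ then (Pi.single (w ⟨x.1, hx⟩) 1 : D x.1 → ℂ) x.2 else 0) q,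
    fun v => ?_⟩
  have hv := eval_multiPoly c (fun s => (Pi.single (v s.1) 1 : D s.1 → ℂ) s.2)
  rw [h, map_mul, ← eval_eq_of_forall_natDegree_blockScale _ hp,
    ← eval_eq_of_forall_natDegree_blockScale _ hq] at hv
  rw [← multiform_single c v]
  refine hv.symm.trans ?_
  congr 3 <;> funext x <;> by_cases hx : x.1 ∈ I <;> simp [hx, restrictTo]

lemma irreducible_multiPoly [Nonempty ι] {c : (∀ i, D i) → ℂ} (hc : c ≠ 0)
    (hent : GenuinelyEntangled D c) : Irreducible (multiPoly c) := by
  have hf := multiPoly_ne_zero hc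
  refine ⟨fun hu => ?_, fun p q h => ?_⟩
  · have h0 := (hu.map (MvPolynomial.eval (0 : (Σ i, D i) → ℂ))).ne_zero
    rw [eval_multiPoly] at h0
    refine h0 (Finset.sum_eq_zero fun v _ => ?_)
    rw [Finset.prod_eq_zero (Finset.mem_univ (Classical.arbitrary ι)) (by simp), mul_zero]
  · have hp : p ≠ 0 := fun h0 => hf (by rw [h, h0, zero_mul])
    have hq : q ≠ 0 := fun h0 => hf (by rw [h, h0, mul_zero])
    set I : Finset ι := Finset.univ.filter fun i => (blockScale i q).natDegree = 0 with hI
    have hqI : ∀ i ∈ I, (blockScale i q).natDegree = 0 := fun i hi => by simpa [hI] using hi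
    have hpI : ∀ i ∈ Iᶜ, (blockScale i p).natDegree = 0 := fun i hi =>
      (natDegree_blockScale_of_mul hc h i).resolve_right (by simpa [hI] using hi)
    by_cases h1 : I = ∅
    · exact Or.inl (isUnit_of_forall_natDegree_blockScale hp fun i => hpI i (by simp [h1]))
    by_cases h2 : I = Finset.univ
    · exact Or.inr (isUnit_of_forall_natDegree_blockScale hq fun i => hqI i (by simp [h2]))
    exact absurd (productAcross_of_mul h I hpI hqI) (hent I h1 h2)

/-- Substitute the `k`-th basis vector for block `i`. -/
noncomputable def blockSubst (i : ι) (k : D i) :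
    MvPolynomial (Σ i, D i) ℂ →ₐ[ℂ] MvPolynomial (Σ i, D i) ℂ :=
  MvPolynomial.bind₁ (fun x => if x.1 = i then
    MvPolynomial.C (if x = ⟨i, k⟩ then 1 else 0) else MvPolynomial.X x)

lemma eval_blockSubst_multiPoly (i : ι) (k : D i) (c : (∀ i, D i) → ℂ) (z : (Σ i, D i) → ℂ) :
    MvPolynomial.eval z (blockSubst i k (multiPoly c)) =
      multiform c (Function.update (fun j l => z ⟨j, l⟩) i (Pi.single k 1)) := by
  have h : ((MvPolynomial.eval z).comp (blockSubst i k).toRingHom) =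
      MvPolynomial.eval (fun x => Function.update (fun j l => z ⟨j, l⟩) i (Pi.single k 1) x.1 x.2) := by
    refine MvPolynomial.ringHom_ext (fun a => by simp [blockSubst]) fun ⟨j, l⟩ => ?_
    by_cases hj : j = i
    · subst hj
      by_cases hl : l = k <;> simp [blockSubst, hl]
    · simp [blockSubst, hj]
  rw [← eval_multiPoly c (fun x =>
    Function.update (fun j l => z ⟨j, l⟩) i (Pi.single k 1) x.1 x.2), ← h]
  rfl

/-- The zero locus of a genuinely entangled form has a point at which the form depends to first
order on every block. -/
lemma exists_multiform_eq_zero [Nonempty ι] {c : (∀ i, D i) → ℂ} (hc : c ≠ 0)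
    (hent : GenuinelyEntangled D c) :
    ∃ (z : ∀ i, D i → ℂ) (v : ∀ i, D i), multiform c z = 0 ∧
      ∀ i, multiform c (Function.update z i (Pi.single (v i) 1)) ≠ 0 := by
  obtain ⟨v, hv⟩ := Function.ne_iff.mp hc
  have hirr := irreducible_multiPoly hc hent
  have hprime : (Ideal.span {multiPoly c}).IsPrime :=
    (Ideal.span_singleton_prime hirr.ne_zero).mpr hirr.prime
  by_contra! hcon
  have hmem : ∏ i, blockSubst i (v i) (multiPoly c) ∈ Ideal.span {multiPoly c} := by
    rw [← MvPolynomial.IsPrime.vanishingIdeal_zeroLocus (K := ℂ) (Ideal.span {multiPoly c}),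
      MvPolynomial.mem_vanishingIdeal_iff]
    intro z hz
    have hz0 : MvPolynomial.eval z (multiPoly c) = 0 := by
      simpa using hz _ (Ideal.mem_span_singleton_self _)
    obtain ⟨i, hi⟩ := hcon (fun i k => z ⟨i, k⟩) v (by rw [← eval_multiPoly, hz0])
    rw [map_prod]
    refine Finset.prod_eq_zero (Finset.mem_univ i) ?_
    rw [← hi, ← eval_blockSubst_multiPoly]
    simp
  obtain ⟨i, _, hi⟩ := hprime.prod_mem_iff.mp hmem
  obtain ⟨q, hq⟩ := Ideal.mem_span_singleton.mp hi
  refine hv ?_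
  have key : ∀ z, MvPolynomial.eval z (blockSubst i (v i) (multiPoly c)) = 0 := by
    intro z
    have h0 : MvPolynomial.eval (fun x => if x.1 = i then 0 else z x)
        (blockSubst i (v i) (multiPoly c)) = 0 := by
      rw [hq, map_mul, eval_multiPoly, multiform, Finset.sum_eq_zero, zero_mul]
      intro w _
      rw [Finset.prod_eq_zero (Finset.mem_univ i) (by simp), mul_zero]
    rw [eval_blockSubst_multiPoly] at h0 ⊢
    rw [← h0]
    congr 1
    funext j l
    by_cases hj : j = i
    · subst hj
      simp
    · simp [hj]
  have h0 := key (fun s => (Pi.single (v s.1) 1 : D s.1 → ℂ) s.2)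
  rw [eval_blockSubst_multiPoly] at h0
  rw [← multiform_single c v, Pi.zero_apply, ← h0]
  congr 1
  funext j l
  by_cases hj : j = i
  · subst hj
    simp
  · simp [hj]

end MultilinearForm

/-! ### Sums of rectangular functions over bipartitions -/

section BipartiteSum

set_option linter.unusedSectionVars false

variable {ι : Type} [Fintype ι] [DecidableEq ι] {X : Type}

/-- `G` is a sum, over nontrivial bipartitions, of nonnegative functions that factorise across the
bipartition. Factorisation is expressed by the exchange identity. -/
def IsBipartiteSum (G : (ι → X) → ℝ) : Prop :=
  ∃ h : Finset ι → (ι → X) → ℝ, (∀ I x, 0 ≤ h I x) ∧ h ∅ = 0 ∧ h Finset.univ = 0 ∧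
    (∀ I x y, h I x * h I y = h I (I.piecewise x y) * h I (I.piecewise y x)) ∧
    ∀ x, ∑ I, h I x = G x

/-- Bipartite sums are closed under pointwise limits. -/
lemma IsBipartiteSum.of_tendsto [Finite X] {α : Type*} {f : Filter α} [f.NeBot]
    {G : α → (ι → X) → ℝ} {G₀ : (ι → X) → ℝ} (hG : ∀ᶠ t in f, IsBipartiteSum (G t))
    (hlim : ∀ x, Filter.Tendsto (fun t => G t x) f (nhds (G₀ x))) : IsBipartiteSum G₀ := by
  have := Fintype.ofFinite X
  obtain ⟨B, hB⟩ : ∃ B, ∀ x, G₀ x < B := by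
    obtain ⟨B, hB⟩ := (Set.finite_range G₀).bddAbove
    exact ⟨B + 1, fun x => (hB ⟨x, rfl⟩).trans_lt (lt_add_one B)⟩
  let K : Set (Finset ι → (ι → X) → ℝ) := Set.Icc 0 (fun _ _ => B) ∩
    {h | h ∅ = 0 ∧ h Finset.univ = 0 ∧
      ∀ I x y, h I x * h I y = h I (I.piecewise x y) * h I (I.piecewise y x)}
  have hK : IsCompact K := by
    refine isCompact_Icc.inter_right (IsClosed.and ?_ (IsClosed.and ?_ ?_))
    · exact isClosed_eq (by fun_prop) (by fun_prop)
    · exact isClosed_eq (by fun_prop) (by fun_prop)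
    · simp only [Set.ofPred_forall]
      exact isClosed_iInter fun I => isClosed_iInter fun x => isClosed_iInter fun y =>
        isClosed_eq (by fun_prop) (by fun_prop)
  let S : (Finset ι → (ι → X) → ℝ) → (ι → X) → ℝ := fun h x => ∑ I, h I x
  have hS : IsClosed (S '' K) := (hK.image (by fun_prop)).isClosed
  have hbound : ∀ᶠ t in f, ∀ x, G t x < B :=
    Filter.eventually_all.mpr fun x => (hlim x).eventually_lt_const (hB x)
  have hmem : G₀ ∈ S '' K := by
    refine hS.mem_of_tendsto (tendsto_pi_nhds.mpr hlim) ?_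
    filter_upwards [hG, hbound] with t ⟨h, h0, h1, h2, h3, h4⟩ hlt
    refine ⟨h, ⟨⟨fun I x => h0 I x, fun I x => ?_⟩, h1, h2, h3⟩, funext h4⟩
    exact (Finset.single_le_sum (fun J _ => h0 J x) (Finset.mem_univ I)).trans
      ((h4 x).trans_le (hlt x).le)
  obtain ⟨h, ⟨⟨h0, -⟩, h1, h2, h3⟩, h4⟩ := hmem
  exact ⟨h, fun I x => h0 I x, h1, h2, h3, fun x => congrFun h4 x⟩

/-- Signs for which the alternating sum singles out the index `i₀`. -/
def pivotSign (i₀ i : ι) : ℝ := if i = i₀ then 1 else -1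

/-- How often each letter other than `i₀` occurs in a word; the entry at `i₀` is their total. -/
def letterCount {H : Type} [Fintype H] (i₀ : ι) (w : H → ι) (j : ι) : Fin (Fintype.card H + 1) :=
  ⟨(Finset.univ.filter fun t => if j = i₀ then w t ≠ i₀ else w t = j).card,
    Nat.lt_succ_of_le (Finset.card_le_univ _)⟩

lemma sum_pivotSign_letterCount {H : Type} [Fintype H] (i₀ : ι) (w : H → ι) :
    ∑ j, pivotSign i₀ j * ((letterCount i₀ w j : ℕ) : ℝ) = 0 := by
  simp only [letterCount, pivotSign, Finset.card_filter, Nat.cast_sum, Finset.mul_sum]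
  rw [Finset.sum_comm]
  refine Finset.sum_eq_zero fun t _ => ?_
  by_cases ht : w t = i₀
  · refine Finset.sum_eq_zero fun j _ => ?_
    by_cases hj : j = i₀
    · simp [hj, ht]
    · simp [hj, ht, Ne.symm hj]
  · rw [← Finset.add_sum_erase _ _ (Finset.mem_univ i₀),
      Finset.sum_eq_single_of_mem (w t) (by simp [ht])]
    · simp [ht]
    · intro j hj hne
      simp [Finset.ne_of_mem_erase hj, hne.symm]

lemma letterCount_line_pivot_eq {H : Type} [Fintype H] (l : Combinatorics.Line ι H) {i₀ j k : ι}
    (hj : j ≠ i₀) (hk : k ≠ i₀) : letterCount i₀ (l j) i₀ = letterCount i₀ (l k) i₀ := by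
  refine Fin.ext (congrArg Finset.card (Finset.filter_congr fun t _ => ?_))
  cases h : l.idxFun t <;> simp [h, hj, hk]

lemma letterCount_line_pivot_lt {H : Type} [Fintype H] (l : Combinatorics.Line ι H) {i₀ j : ι}
    (hj : j ≠ i₀) : letterCount i₀ (l i₀) i₀ < letterCount i₀ (l j) i₀ := by
  obtain ⟨t, ht⟩ := l.proper
  refine Finset.card_lt_card (Finset.ssubset_iff_of_subset ?_ |>.mpr ⟨t, ?_, ?_⟩)
  · intro s
    cases h : l.idxFun s <;> simp [h]
  · simp [ht, hj]
  · simp [ht]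

lemma letterCount_line_of_ne {H : Type} [Fintype H] (l : Combinatorics.Line ι H) {i₀ j k : ι}
    (hk : k ≠ i₀) (hkj : k ≠ j) : letterCount i₀ (l j) k = letterCount i₀ (l i₀) k := by
  refine Fin.ext (congrArg Finset.card (Finset.filter_congr fun t _ => ?_))
  cases h : l.idxFun t <;> simp [h, hk, hk.symm, hkj.symm]

/-- By the Hales-Jewett theorem, the square of a signed sum is not a bipartite sum on a large
enough grid: a rectangle through a point with nonzero sum is forced to meet the zero set. -/
lemma exists_not_isBipartiteSum_sq [Nontrivial ι] (i₀ : ι) :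
    ∃ N : ℕ, ¬ IsBipartiteSum fun x : ι → Fin N =>
      (∑ i, pivotSign i₀ i * ((x i : ℕ) : ℝ)) ^ 2 := by
  obtain ⟨H, _, hH⟩ := Combinatorics.Line.exists_mono_in_high_dimension ι (Finset ι → Prop × Prop)
  refine ⟨Fintype.card H + 1, fun ⟨h, h0, hempty, huniv, hcross, hsum⟩ => ?_⟩
  beta_reduce at hsum
  obtain ⟨l, color, hl⟩ := hH fun w I =>
    (∃ y, (∀ i ∈ I, y i = letterCount i₀ w i) ∧ 0 < h I y,
      ∃ y, (∀ i ∉ I, y i = letterCount i₀ w i) ∧ 0 < h I y)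
  obtain ⟨j₁, hj₁⟩ := exists_ne i₀
  set b := letterCount i₀ (l i₀) with hb
  set E := Function.update b i₀ (letterCount i₀ (l j₁) i₀) with hE
  have hEb : ∀ k, k ≠ i₀ → E k = b k := fun k hk => by simp [hE, hk]
  have hEl : ∀ j k, j ≠ i₀ → k ≠ j → E k = letterCount i₀ (l j) k := by
    intro j k hj hkj
    by_cases hk : k = i₀
    · subst hk
      simp [hE, letterCount_line_pivot_eq l hj₁ hj]
    · rw [hEb k hk, hb, letterCount_line_of_ne l hk hkj]
  have hEpos : 0 < ∑ I, h I E := by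
    rw [hsum]
    have hdiff : ∑ i, pivotSign i₀ i * ((E i : ℕ) : ℝ) = (E i₀ : ℕ) - (b i₀ : ℕ) := by
      rw [← sub_zero (∑ i, pivotSign i₀ i * ((E i : ℕ) : ℝ)),
        ← sum_pivotSign_letterCount i₀ (l i₀), ← Finset.sum_sub_distrib,
        Finset.sum_eq_single i₀]
      · simp [pivotSign, hb]
      · intro k _ hk
        rw [hEb k hk, sub_self]
      · simp
    have hlt : ((b i₀ : ℕ) : ℝ) < (E i₀ : ℕ) := by
      have := letterCount_line_pivot_lt l hj₁
      simp only [hE, Function.update_self]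
      exact_mod_cast this
    rw [hdiff]
    exact pow_pos (sub_pos.mpr hlt) 2
  obtain ⟨I, -, hI⟩ := Finset.exists_lt_of_sum_lt (f := fun _ => (0 : ℝ)) (by simpa using hEpos)
  have hI1 : I ≠ ∅ := fun h1 => by simp [h1, hempty] at hI
  have hI2 : I ≠ Finset.univ := fun h1 => by simp [h1, huniv] at hI
  have hzero : h I b = 0 := by
    have hs := hsum b
    rw [sum_pivotSign_letterCount, zero_pow two_ne_zero,
      Finset.sum_eq_zero_iff_of_nonneg fun J _ => h0 J b] at hs
    exact hs I (Finset.mem_univ I)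
  have hcol : ∀ j, _ := fun j => congrFun ((hl j).trans (hl i₀).symm) I
  suffices hrect : (∃ y, (∀ i ∈ I, y i = b i) ∧ 0 < h I y) ∧
      ∃ y, (∀ i ∉ I, y i = b i) ∧ 0 < h I y by
    obtain ⟨⟨y, hy, hy0⟩, y', hy', hy0'⟩ := hrect
    have hp : I.piecewise y y' = b := by
      funext i
      by_cases hi : i ∈ I <;> simp [hi, hy, hy']
    have := hcross I y y'
    rw [hp, hzero, zero_mul] at this
    exact (mul_pos hy0 hy0').ne' this
  by_cases hi₀ : i₀ ∈ I
  · obtain ⟨j, hj⟩ : ∃ j, j ∉ I := by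
      by_contra! hall
      exact hI2 (Finset.eq_univ_iff_forall.mpr hall)
    have hji : j ≠ i₀ := fun e => hj (e ▸ hi₀)
    refine ⟨(congrArg Prod.fst (hcol j)).mp ⟨E, fun i hi => ?_, hI⟩, E, fun i hi => ?_, hI⟩
    · exact hEl j i hji fun e => hj (e ▸ hi)
    · exact hEb i fun e => hi (e ▸ hi₀)
  · obtain ⟨j, hj⟩ := Finset.nonempty_iff_ne_empty.mpr hI1
    have hji : j ≠ i₀ := fun e => hi₀ (e ▸ hj)
    refine ⟨⟨E, fun i hi => ?_, hI⟩, (congrArg Prod.snd (hcol j)).mp ⟨E, fun i hi => ?_, hI⟩⟩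
    · exact hEb i fun e => hi₀ (e ▸ hi)
    · exact hEl j i hji fun e => hi (e ▸ hj)

end BipartiteSum

/-! ### Born-rule distributions -/

section Born

set_option linter.unusedSectionVars false

variable {ι : Type} [Fintype ι] [DecidableEq ι] {D : ι → Type} [∀ i, Fintype (D i)]
  [∀ i, DecidableEq (D i)]

lemma tensorOp_mul (A B : ∀ i, Matrix (D i) (D i) ℂ) :
    tensorOp D A * tensorOp D B = tensorOp D fun i => A i * B i := by
  ext v w
  simp only [Matrix.mul_apply, tensorOp, Matrix.of_apply, ← Finset.prod_mul_distrib]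
  rw [Fintype.prod_sum]

lemma conjTranspose_tensorOp (A : ∀ i, Matrix (D i) (D i) ℂ) :
    (tensorOp D A).conjTranspose = tensorOp D fun i => (A i).conjTranspose := by
  ext v w
  simp [tensorOp, Matrix.conjTranspose_apply]

lemma tensorOp_one : tensorOp D (fun _ => 1) = 1 := by
  ext v w
  by_cases h : v = w
  · subst h
    simp [tensorOp]
  · obtain ⟨i, hi⟩ := Function.ne_iff.mp h
    rw [Matrix.one_apply_ne h, tensorOp, Matrix.of_apply]
    exact Finset.prod_eq_zero (Finset.mem_univ i) (Matrix.one_apply_ne hi)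

open scoped MatrixOrder in
lemma posSemidef_tensorOp {A : ∀ i, Matrix (D i) (D i) ℂ} (hA : ∀ i, (A i).PosSemidef) :
    (tensorOp D A).PosSemidef := by
  choose B hB using fun i => CStarAlgebra.nonneg_iff_eq_star_mul_self.mp (hA i).nonneg
  have : tensorOp D A = (tensorOp D B).conjTranspose * tensorOp D B := by
    rw [conjTranspose_tensorOp, tensorOp_mul]
    exact congrArg _ (funext hB)
  rw [this]
  exact Matrix.posSemidef_conjTranspose_mul_self _

lemma trace_tensorOp_mul_outerProj (A : ∀ i, Matrix (D i) (D i) ℂ) (ψ : (∀ i, D i) → ℂ) :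
    (tensorOp D A * outerProj D ψ).trace =
      ∑ v, ∑ w, (∏ i, A i (v i) (w i)) * (ψ w * starRingEnd ℂ (ψ v)) := by
  simp [Matrix.trace, Matrix.mul_apply, tensorOp, outerProj]

lemma trace_tensorOp_mul_outerProj_nonneg {A : ∀ i, Matrix (D i) (D i) ℂ}
    (hA : ∀ i, (A i).PosSemidef) (ψ : (∀ i, D i) → ℂ) :
    0 ≤ (tensorOp D A * outerProj D ψ).trace := by
  have h : (tensorOp D A * outerProj D ψ).trace =
      dotProduct (star ψ) ((tensorOp D A).mulVec ψ) := by
    rw [trace_tensorOp_mul_outerProj]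
    simp only [dotProduct, Matrix.mulVec, Finset.mul_sum, tensorOp, Matrix.of_apply, Pi.star_apply]
    exact Finset.sum_congr rfl fun v _ => Finset.sum_congr rfl fun w _ => by
      rw [starRingEnd_apply]; ring
  rw [h]
  exact (posSemidef_tensorOp hA).dotProduct_mulVec_nonneg ψ

lemma sum_bornDist_update (o s : ι → ℕ) (ψ : (∀ i, D i) → ℂ)
    {M : ∀ i, Fin (s i) → Fin (o i) → Matrix (D i) (D i) ℂ} (hM : ∀ i x, IsPOVM (M i x)) (i : ι)
    (a : ∀ i, Fin (o i)) (x : ∀ i, Fin (s i)) :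
    ∑ k, BornDist D o s (outerProj D ψ) M (Function.update a i k) x =
      (tensorOp D (fun j => if j = i then 1 else M j (x j) (a j)) * outerProj D ψ).trace.re := by
  have key : ∑ k, tensorOp D (fun j => M j (x j) (Function.update a i k j)) =
      tensorOp D (fun j => if j = i then 1 else M j (x j) (a j)) := by
    ext v w
    simp only [tensorOp, Matrix.sum_apply, Matrix.of_apply]
    simp_rw [← Finset.mul_prod_erase _ _ (Finset.mem_univ i)]
    simp only [Function.update_self, if_true, ← (hM i (x i)).2, Matrix.sum_apply, Finset.sum_mul]
    refine Finset.sum_congr rfl fun k _ => congrArg _ (Finset.prod_congr rfl fun j hj => ?_)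
    rw [Function.update_of_ne (Finset.ne_of_mem_erase hj), if_neg (Finset.ne_of_mem_erase hj)]
  simp only [BornDist]
  rw [← Complex.re_sum, ← Matrix.trace_sum, ← Finset.sum_mul, key]

lemma noSignalling_bornDist (o s : ι → ℕ) {ψ : (∀ i, D i) → ℂ}
    (hψ : ∑ v, Complex.normSq (ψ v) = 1)
    {M : ∀ i, Fin (s i) → Fin (o i) → Matrix (D i) (D i) ℂ} (hM : ∀ i x, IsPOVM (M i x)) :
    NoSignalling (fun i => Fin (o i)) (fun i => Fin (s i))
      (BornDist D o s (outerProj D ψ) M) := by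
  refine ⟨⟨fun a x => ?_, fun x => ?_⟩, fun i a x x' hx => ?_⟩
  · exact (Complex.nonneg_iff.mp
      (trace_tensorOp_mul_outerProj_nonneg (fun i => (hM i (x i)).1 (a i)) ψ)).1
  · have key : ∑ a : ∀ i, Fin (o i), tensorOp D (fun j => M j (x j) (a j)) = 1 := by
      rw [← tensorOp_one]
      ext v w
      simp only [tensorOp, Matrix.sum_apply, Matrix.of_apply, ← (hM _ (x _)).2]
      rw [Fintype.prod_sum]
    simp only [BornDist]
    rw [← Complex.re_sum, ← Matrix.trace_sum, ← Finset.sum_mul, key, one_mul]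
    simp [Matrix.trace, outerProj, Complex.mul_conj, hψ]
  · rw [sum_bornDist_update o s ψ hM, sum_bornDist_update o s ψ hM]
    congr 4
    funext j
    split_ifs with hj
    · rfl
    · rw [hx j hj]

/-- A tuple amounts to its restrictions to a set of indices and to the complement. -/
def restrictEquiv (A : ι → Type) (I : Finset ι) :
    (∀ i, A i) ≃ (∀ i : {j // j ∈ I}, A i.1) × (∀ i : {j // j ∈ Iᶜ}, A i.1) where
  toFun v := (restrictTo I v, restrictTo Iᶜ v)
  invFun p i := if h : i ∈ I then p.1 ⟨i, h⟩ else p.2 ⟨i, Finset.mem_compl.mpr h⟩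
  left_inv v := by
    funext i
    by_cases h : i ∈ I <;> simp [h, restrictTo]
  right_inv p := by
    refine Prod.ext (funext fun i => ?_) (funext fun i => ?_)
    · simp [restrictTo, i.2]
    · simp [restrictTo, Finset.mem_compl.mp i.2]

lemma sum_eq_sum_restrictTo (I : Finset ι)
    (f : (∀ i : {j // j ∈ I}, D i.1) → (∀ i : {j // j ∈ Iᶜ}, D i.1) → ℂ) :
    ∑ v : ∀ i, D i, f (restrictTo I v) (restrictTo Iᶜ v) = ∑ v, ∑ w, f v w := by
  rw [← Fintype.sum_prod_type']
  exact (restrictEquiv D I).sum_comp fun p => f p.1 p.2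

lemma trace_eq_mul_of_productAcross (I : Finset ι) {ψ : (∀ i, D i) → ℂ}
    {φ : (∀ i : {j // j ∈ I}, D i.1) → ℂ} {χ : (∀ i : {j // j ∈ Iᶜ}, D i.1) → ℂ}
    (h : ∀ v, ψ v = φ (restrictTo I v) * χ (restrictTo Iᶜ v)) (A : ∀ i, Matrix (D i) (D i) ℂ) :
    (tensorOp D A * outerProj D ψ).trace =
      (tensorOp (fun i : {j // j ∈ I} => D i.1) (fun i => A i.1) * outerProj _ φ).trace *
      (tensorOp (fun i : {j // j ∈ Iᶜ} => D i.1) (fun i => A i.1) * outerProj _ χ).trace := by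
  simp only [trace_tensorOp_mul_outerProj]
  rw [Finset.sum_mul_sum, ← sum_eq_sum_restrictTo]
  refine Finset.sum_congr rfl fun v _ => ?_
  rw [Finset.sum_mul_sum, ← sum_eq_sum_restrictTo]
  refine Finset.sum_congr rfl fun w _ => ?_
  rw [h v, h w, map_mul, ← Finset.prod_mul_prod_compl I, ← Finset.prod_coe_sort I,
    ← Finset.prod_coe_sort Iᶜ]
  simp only [restrictTo]
  ring

lemma sum_normSq_mul_of_productAcross (I : Finset ι) {ψ : (∀ i, D i) → ℂ}
    {φ : (∀ i : {j // j ∈ I}, D i.1) → ℂ} {χ : (∀ i : {j // j ∈ Iᶜ}, D i.1) → ℂ}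
    (h : ∀ v, ψ v = φ (restrictTo I v) * χ (restrictTo Iᶜ v)) :
    ∑ v, Complex.normSq (ψ v) =
      (∑ v, Complex.normSq (φ v)) * ∑ v, Complex.normSq (χ v) := by
  apply Complex.ofReal_injective
  push_cast
  rw [Finset.sum_mul_sum, ← sum_eq_sum_restrictTo]
  exact Finset.sum_congr rfl fun v _ => by rw [h v, map_mul, Complex.ofReal_mul]

/-- A unit vector that is a product across a bipartition is a product of unit vectors. -/
lemma ProductAcross.exists_normalized {I : Finset ι} {ψ : (∀ i, D i) → ℂ}
    (hψ : ∑ v, Complex.normSq (ψ v) = 1) (h : ProductAcross D I ψ) :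
    ∃ (φ : (∀ i : {j // j ∈ I}, D i.1) → ℂ) (χ : (∀ i : {j // j ∈ Iᶜ}, D i.1) → ℂ),
      (∑ v, Complex.normSq (φ v) = 1) ∧ (∑ v, Complex.normSq (χ v) = 1) ∧
      ∀ v, ψ v = φ (restrictTo I v) * χ (restrictTo Iᶜ v) := by
  obtain ⟨φ, χ, h⟩ := h
  set r := ∑ v, Complex.normSq (φ v) with hr
  have hmul : r * ∑ v, Complex.normSq (χ v) = 1 := by
    rw [hr, ← sum_normSq_mul_of_productAcross I h, hψ]
  have hr0 : 0 < r := lt_of_le_of_ne (Finset.sum_nonneg fun v _ => Complex.normSq_nonneg _)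
    fun e => by simp [← e] at hmul
  have hsq : Complex.normSq (Real.sqrt r : ℂ) = r := by
    rw [Complex.normSq_ofReal, Real.mul_self_sqrt hr0.le]
  have hne : (Real.sqrt r : ℂ) ≠ 0 := by
    exact_mod_cast (Real.sqrt_pos.mpr hr0).ne'
  refine ⟨fun v => (Real.sqrt r : ℂ)⁻¹ * φ v, fun v => (Real.sqrt r : ℂ) * χ v, ?_, ?_, fun v => ?_⟩
  · simp only [map_mul, map_inv₀, hsq, ← Finset.mul_sum]
    exact inv_mul_cancel₀ hr0.ne'
  · simp only [map_mul, hsq, ← Finset.mul_sum, hmul]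
  · rw [h v]
    field_simp

lemma sum_normSq_single {κ : Type} [Fintype κ] [DecidableEq κ] (k : κ) :
    ∑ v, Complex.normSq ((Pi.single k 1 : κ → ℂ) v) = 1 := by
  rw [Finset.sum_eq_single k] <;> simp +contextual

/-- Measuring a product state yields a product of no-signalling distributions. -/
lemma biseparableNS_bornDist {I : Finset ι} (hI : I ≠ ∅) (hI' : I ≠ Finset.univ)
    {ψ : (∀ i, D i) → ℂ} (hψ : ∑ v, Complex.normSq (ψ v) = 1) (h : ProductAcross D I ψ)
    (o s : ι → ℕ) {M : ∀ i, Fin (s i) → Fin (o i) → Matrix (D i) (D i) ℂ}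
    (hM : ∀ i x, IsPOVM (M i x)) :
    BiseparableNS (fun i => Fin (o i)) (fun i => Fin (s i))
      (BornDist D o s (outerProj D ψ) M) := by
  obtain ⟨φ, χ, hφ, hχ, h⟩ := h.exists_normalized hψ
  obtain ⟨v₀⟩ : Nonempty (∀ i, D i) := by
    by_contra hempty
    rw [not_nonempty_iff] at hempty
    simp at hψ
  let Φ : ∀ J : Finset ι, (∀ i : {j // j ∈ J}, D i.1) → ℂ :=
    Function.update (fun J => Pi.single (restrictTo J v₀) 1) I φ
  let Θ : ∀ J : Finset ι, (∀ i : {j // j ∈ Jᶜ}, D i.1) → ℂ :=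
    Function.update (fun J => Pi.single (restrictTo Jᶜ v₀) 1) I χ
  have hΦ : ∀ J, ∑ v, Complex.normSq (Φ J v) = 1 := fun J => by
    by_cases hJ : J = I
    · subst hJ
      simpa [Φ] using hφ
    · simpa only [Φ, Function.update_of_ne hJ] using sum_normSq_single _
  have hΘ : ∀ J, ∑ v, Complex.normSq (Θ J v) = 1 := fun J => by
    by_cases hJ : J = I
    · subst hJ
      simpa [Θ] using hχ
    · simpa only [Θ, Function.update_of_ne hJ] using sum_normSq_single _
  refine ⟨Pi.single I 1,
    fun J => BornDist _ (fun i : {j // j ∈ J} => o i.1) (fun i => s i.1) (outerProj _ (Φ J))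
      fun i => M i.1,
    fun J => BornDist _ (fun i : {j // j ∈ Jᶜ} => o i.1) (fun i => s i.1) (outerProj _ (Θ J))
      fun i => M i.1,
    fun J => ?_, ?_, fun J hJ => ?_, fun J => ?_, fun J => ?_, fun a x => ?_⟩
  · by_cases hJ : J = I
    · simp [hJ]
    · simp [hJ]
  · simp
  · obtain rfl : J = I := by
      by_contra hne
      simp [hne] at hJ
    exact ⟨hI, hI'⟩
  · exact noSignalling_bornDist (fun i : {j // j ∈ J} => o i.1) (fun i => s i.1) (hΦ J)
      fun i => hM i.1
  · exact noSignalling_bornDist (fun i : {j // j ∈ Jᶜ} => o i.1) (fun i => s i.1) (hΘ J)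
      fun i => hM i.1
  · rw [Finset.sum_eq_single I]
    · simp only [Pi.single_eq_same, one_mul, BornDist, Φ, Θ, Function.update_self]
      rw [trace_eq_mul_of_productAcross I h, Complex.mul_re]
      have h1 := trace_tensorOp_mul_outerProj_nonneg
        (fun i : {j // j ∈ I} => (hM i.1 (x i.1)).1 (a i.1)) φ
      rw [← (Complex.nonneg_iff.mp h1).2, zero_mul, sub_zero]
      rfl
    · intro J _ hJ
      simp [hJ]
    · simp

end Born

/-! ### Rank-one measurements -/

section RankOne

set_option linter.unusedSectionVars false

variable {ι : Type} [Fintype ι] [DecidableEq ι] {D : ι → Type} [∀ i, Fintype (D i)]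
  [∀ i, DecidableEq (D i)]

lemma trace_tensorOp_vecMulVec_mul_outerProj (r : ι → ℝ) (u : ∀ i, D i → ℂ)
    (ψ : (∀ i, D i) → ℂ) :
    (tensorOp D (fun i => (r i : ℂ) • Matrix.vecMulVec (u i) (star (u i))) *
      outerProj D ψ).trace =
      (((∏ i, r i) * Complex.normSq (multiform (star ψ) u) : ℝ) : ℂ) := by
  rw [trace_tensorOp_mul_outerProj, Complex.ofReal_mul, Complex.normSq_eq_conj_mul_self, multiform,
    mul_comm (starRingEnd ℂ _), map_sum, Finset.sum_mul_sum, Finset.mul_sum]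
  refine Finset.sum_congr rfl fun v _ => ?_
  rw [Finset.mul_sum]
  refine Finset.sum_congr rfl fun w _ => ?_
  simp only [Matrix.smul_apply, Matrix.vecMulVec_apply, smul_eq_mul, Finset.prod_mul_distrib,
    Pi.star_apply, RCLike.star_def, map_mul, map_prod, Complex.conj_conj, Complex.ofReal_prod]
  ring

/-- The weight making a rank-one operator an effect with full-rank complement. -/
noncomputable def effectWeight {d : Type} [Fintype d] (u : d → ℂ) : ℝ :=
  (1 + ∑ k, Complex.normSq (u k))⁻¹

lemma effectWeight_pos {d : Type} [Fintype d] (u : d → ℂ) : 0 < effectWeight u :=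
  inv_pos.mpr (add_pos_of_pos_of_nonneg one_pos
    (Finset.sum_nonneg fun _ _ => Complex.normSq_nonneg _))

/-- The dichotomic measurement whose first effect is proportional to the projector onto `u`. -/
noncomputable def dichotomicPOVM {d : Type} [Fintype d] [DecidableEq d] (u : d → ℂ) :
    Fin 2 → Matrix d d ℂ :=
  ![(effectWeight u : ℂ) • Matrix.vecMulVec u (star u),
    1 - (effectWeight u : ℂ) • Matrix.vecMulVec u (star u)]

lemma isPOVM_dichotomicPOVM {d : Type} [Fintype d] [DecidableEq d] (u : d → ℂ) :
    IsPOVM (dichotomicPOVM u) := by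
  set U := Matrix.vecMulVec u (star u) with hU
  set c : ℂ := (effectWeight u : ℂ) with hc
  have hc0 : 0 ≤ c := Complex.zero_le_real.mpr (effectWeight_pos u).le
  have hUpos : U.PosSemidef := Matrix.posSemidef_vecMulVec_self_star u
  have hcU : (c • U).PosSemidef := hUpos.smul hc0
  refine ⟨fun a => ?_, by simp [dichotomicPOVM]⟩
  fin_cases a
  · exact hcU
  · set S : ℂ := ((∑ k, Complex.normSq (u k) : ℝ) : ℂ) with hS
    have hUU : U * U = S • U := by
      rw [hU, Matrix.vecMulVec_mul_vecMulVec]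
      ext i j
      simp [Matrix.vecMulVec_apply, dotProduct, hS, Complex.normSq_eq_conj_mul_self]
      ring
    have hcS : c * (1 + S) = 1 := by
      have : effectWeight u * (1 + ∑ k, Complex.normSq (u k)) = 1 :=
        inv_mul_cancel₀ (inv_pos.mp (effectWeight_pos u)).ne'
      rw [hc, hS]
      exact_mod_cast this
    have hsplit : 1 - c • U = (1 - c • U).conjTranspose * (1 - c • U) + (c ^ 2) • U := by
      rw [Matrix.conjTranspose_sub, Matrix.conjTranspose_one, hcU.isHermitian.eq, sub_mul, one_mul,
        mul_sub, mul_one, Matrix.smul_mul, Matrix.mul_smul, hUU, smul_smul, smul_smul]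
      have : c = c ^ 2 + c * (c * S) := by linear_combination -c * hcS
      nth_rewrite 3 [this]
      module
    change (1 - c • U).PosSemidef
    rw [hsplit]
    exact (Matrix.posSemidef_conjTranspose_mul_self _).add (hUpos.smul (pow_nonneg hc0 2))

/-- The derivative of a multilinear form at one of its zeros. -/
lemma tendsto_multiform_div {c : (∀ i, D i) → ℂ} {z : ∀ i, D i → ℂ} (hz : multiform c z = 0)
    (y : ∀ i, D i → ℂ) :
    Filter.Tendsto (fun t : ℂ => multiform c (fun i => z i + t • y i) / t)
      (nhdsWithin 0 {0}ᶜ) (nhds (∑ i, multiform c (Function.update z i (y i)))) := by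
  have hderiv : HasDerivAt (fun t : ℂ => multiform c (fun i => z i + t • y i))
      (∑ i, multiform c (Function.update z i (y i))) 0 := by
    have hv : ∀ v : ∀ i, D i, HasDerivAt (fun t : ℂ => c v * ∏ i, (z i + t • y i) (v i))
        (c v * ∑ i, ∏ j, Function.update z i (y i) j (v j)) 0 := by
      intro v
      have h1 : ∀ i ∈ (Finset.univ : Finset ι),
          HasDerivAt (fun t : ℂ => (z i + t • y i) (v i)) (y i (v i)) 0 := fun i _ => by
        simpa using ((hasDerivAt_id (0 : ℂ)).mul_const (y i (v i))).const_add (z i (v i))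
      refine ((HasDerivAt.fun_finsetProd h1).const_mul (c v)).congr_deriv ?_
      refine congrArg _ (Finset.sum_congr rfl fun i _ => ?_)
      rw [← Finset.mul_prod_erase _ _ (Finset.mem_univ i), Function.update_self, smul_eq_mul,
        mul_comm]
      congr 1
      refine Finset.prod_congr rfl fun j hj => ?_
      simp [Function.update_of_ne (Finset.ne_of_mem_erase hj)]
    refine (HasDerivAt.fun_sum (u := Finset.univ) fun v _ => hv v).congr_deriv ?_
    simp only [multiform, Finset.mul_sum]
    exact Finset.sum_comm
  have h := hasDerivAt_iff_tendsto_slope_zero.mp hderiv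
  simpa [hz, div_eq_inv_mul] using h

lemma multiform_update_smul (c : (∀ i, D i) → ℂ) (z : ∀ i, D i → ℂ) (i : ι) (a : ℂ)
    (w : D i → ℂ) : multiform c (Function.update z i (a • w)) =
      a * multiform c (Function.update z i w) := by
  simp only [multiform, Finset.mul_sum]
  refine Finset.sum_congr rfl fun v _ => ?_
  rw [← Finset.mul_prod_erase _ (fun j => Function.update z i (a • w) j (v j))
      (Finset.mem_univ i),
    ← Finset.mul_prod_erase _ (fun j => Function.update z i w j (v j)) (Finset.mem_univ i),
    Function.update_self, Function.update_self, Pi.smul_apply, smul_eq_mul]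
  have : ∏ j ∈ Finset.univ.erase i, Function.update z i (a • w) j (v j) =
      ∏ j ∈ Finset.univ.erase i, Function.update z i w j (v j) :=
    Finset.prod_congr rfl fun j hj => by
      rw [Function.update_of_ne (Finset.ne_of_mem_erase hj),
        Function.update_of_ne (Finset.ne_of_mem_erase hj)]
  rw [this]
  ring

lemma GenuinelyEntangled.conj {ψ : (∀ i, D i) → ℂ} (h : GenuinelyEntangled D ψ) :
    GenuinelyEntangled D (star ψ) := by
  rintro I hI hI' ⟨φ, χ, hφ⟩
  refine h I hI hI' ⟨star φ, star χ, fun v => ?_⟩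
  have := congrArg star (hφ v)
  simpa [mul_comm] using this

end RankOne

section Extraction

variable {ι : Type} [Fintype ι] [DecidableEq ι] {X : Type}

lemma IsBipartiteSum.mul_prod {G : (ι → X) → ℝ} (hG : IsBipartiteSum G) {k : ℝ} (hk : 0 ≤ k)
    {w : ι → X → ℝ} (hw : ∀ i x, 0 ≤ w i x) :
    IsBipartiteSum fun x => k * (∏ i, w i (x i)) * G x := by
  obtain ⟨h, h0, hempty, huniv, hcross, hsum⟩ := hG
  refine ⟨fun I x => k * (∏ i, w i (x i)) * h I x, fun I x => ?_, ?_, ?_, fun I x y => ?_,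
    fun x => ?_⟩
  · exact mul_nonneg (mul_nonneg hk (Finset.prod_nonneg fun i _ => hw i _)) (h0 I x)
  · funext x
    simp [hempty]
  · funext x
    simp [huniv]
  · have hprod : (∏ i, w i (x i)) * ∏ i, w i (y i) =
        (∏ i, w i (I.piecewise x y i)) * ∏ i, w i (I.piecewise y x i) := by
      simp only [← Finset.prod_mul_distrib]
      refine Finset.prod_congr rfl fun i _ => ?_
      by_cases hi : i ∈ I
      · simp [hi]
      · simp [hi, mul_comm]
    linear_combination k ^ 2 * ((∏ i, w i (x i)) * ∏ i, w i (y i)) * hcross I x y +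
      k ^ 2 * (h I (I.piecewise x y) * h I (I.piecewise y x)) * hprod
  · simp only [← hsum x, Finset.mul_sum]

lemma BiseparableNS.isBipartiteSum {A : ι → Type} [∀ i, Fintype (A i)] [Fintype X]
    {P : (∀ i, A i) → (ι → X) → ℝ} (hP : BiseparableNS A (fun _ => X) P) (a : ∀ i, A i) :
    IsBipartiteSum (P a) := by
  obtain ⟨p, Q, R, hp, -, hsupp, hQ, hR, hdecomp⟩ := hP
  refine ⟨fun I x => p I * Q I (restrictTo I a) (restrictTo I x) *
      R I (restrictTo Iᶜ a) (restrictTo Iᶜ x), fun I x => ?_, ?_, ?_, fun I x y => ?_,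
    fun x => (hdecomp a x).symm⟩
  · exact mul_nonneg (mul_nonneg (hp I) ((hQ I).1.1 _ _)) ((hR I).1.1 _ _)
  · have : p ∅ = 0 := by
      by_contra h
      exact (hsupp _ h).1 rfl
    funext x
    simp [this]
  · have : p Finset.univ = 0 := by
      by_contra h
      exact (hsupp _ h).2 rfl
    funext x
    simp [this]
  · have hin : ∀ x y : ι → X,
        (restrictTo I (I.piecewise x y) : {j // j ∈ I} → X) = restrictTo I x :=
      fun x y => funext fun i => Finset.piecewise_eq_of_mem _ _ _ i.2
    have hout : ∀ x y : ι → X,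
        (restrictTo Iᶜ (I.piecewise x y) : {j // j ∈ Iᶜ} → X) = restrictTo Iᶜ y :=
      fun x y => funext fun i =>
        Finset.piecewise_eq_of_notMem _ _ _ (Finset.mem_compl.mp i.2)
    simp only [hin, hout]
    ring

end Extraction

/-- A genuinely entangled vector violates biseparability for suitable rank-one measurements. -/
lemma GenuinelyEntangled.exists_not_biseparableNS {ι : Type} [Fintype ι] [DecidableEq ι]
    [Nontrivial ι] {D : ι → Type} [∀ i, Fintype (D i)] [∀ i, DecidableEq (D i)]
    {ψ : (∀ i, D i) → ℂ} (hψ : ψ ≠ 0) (hent : GenuinelyEntangled D ψ) :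
    ∃ (o s : ι → ℕ) (M : ∀ i, Fin (s i) → Fin (o i) → Matrix (D i) (D i) ℂ),
      (∀ i x, IsPOVM (M i x)) ∧
      ¬ BiseparableNS (fun i => Fin (o i)) (fun i => Fin (s i))
        (BornDist D o s (outerProj D ψ) M) := by
  obtain ⟨z, v, hz, hL⟩ := exists_multiform_eq_zero (star_ne_zero.mpr hψ) hent.conj
  obtain ⟨i₀⟩ := (inferInstance : Nonempty ι)
  obtain ⟨N, hN⟩ := exists_not_isBipartiteSum_sq i₀
  by_contra! hall
  let L : ι → ℂ := fun i => multiform (star ψ) (Function.update z i (Pi.single (v i) 1))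
  let y : ∀ i, Fin N → D i → ℂ := fun i k =>
    (((pivotSign i₀ i * ((k : ℕ) : ℝ) : ℝ) : ℂ) / L i) • Pi.single (v i) 1
  let u : ℂ → ∀ i, Fin N → D i → ℂ := fun t i k => z i + t • y i k
  refine hN (IsBipartiteSum.of_tendsto (f := nhdsWithin (0 : ℂ) {0}ᶜ)
    (G := fun t x => Complex.normSq (multiform (star ψ) (fun i => u t i (x i)) / t)) ?_ ?_)
  · refine Filter.Eventually.of_forall fun t => ?_
    have hB := hall (fun _ => 2) (fun _ => N) (fun i k => dichotomicPOVM (u t i k))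
      fun i k => isPOVM_dichotomicPOVM _
    convert (hB.isBipartiteSum fun _ => (0 : Fin 2)).mul_prod
      (inv_nonneg.mpr (Complex.normSq_nonneg t))
      (w := fun i k => (effectWeight (u t i k))⁻¹)
      (fun i k => (inv_pos.mpr (effectWeight_pos _)).le) using 2 with x
    have hborn := trace_tensorOp_vecMulVec_mul_outerProj
      (fun i => effectWeight (u t i (x i))) (fun i => u t i (x i)) ψ
    have hprod : ∏ i, effectWeight (u t i (x i)) ≠ 0 :=
      Finset.prod_ne_zero_iff.mpr fun i _ => (effectWeight_pos _).ne'
    have hval : BornDist D (fun _ => 2) (fun _ => N) (outerProj D ψ)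
        (fun i k => dichotomicPOVM (u t i k)) (fun _ => (0 : Fin 2)) x =
        (∏ i, effectWeight (u t i (x i))) *
          Complex.normSq (multiform (star ψ) fun i => u t i (x i)) := by
      rw [← Complex.ofReal_re ((∏ i, _) * _), ← hborn]
      rfl
    rw [hval, map_div₀, Finset.prod_inv_distrib]
    field_simp
  · intro x
    have h := tendsto_multiform_div hz fun i => y i (x i)
    have hsum : ∑ i, multiform (star ψ) (Function.update z i (y i (x i))) =
        ((∑ i, pivotSign i₀ i * ((x i : ℕ) : ℝ) : ℝ) : ℂ) := by
      rw [Complex.ofReal_sum]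
      refine Finset.sum_congr rfl fun i _ => ?_
      rw [multiform_update_smul]
      exact div_mul_cancel₀ _ (hL i)
    rw [hsum] at h
    have := (Complex.continuous_normSq.tendsto _).comp h
    rw [Complex.normSq_ofReal, ← sq] at this
    exact this
/-- for pure states, genuine multipartite entanglement and genuine
multipartite nonlocality are equivalent: a unit vector `ψ` on a finite-dimensional
`n`-partite Hilbert space is not a product across any nontrivial bipartition iff
some Born-rule distribution obtained from it by local POVMs admits no biseparable
no-signalling decomposition. -/
theorem GME_iff_GMN (n : ℕ) (hn : 2 ≤ n)
    (D : Fin n → Type) [∀ i, Fintype (D i)] [∀ i, DecidableEq (D i)]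
    (ψ : (∀ i, D i) → ℂ) (hψ : ∑ v, Complex.normSq (ψ v) = 1) :
    GenuinelyEntangled D ψ ↔
      ∃ (o s : Fin n → ℕ) (M : ∀ i, Fin (s i) → Fin (o i) → Matrix (D i) (D i) ℂ),
        (∀ i x, IsPOVM (M i x)) ∧
        ¬ BiseparableNS (fun i => Fin (o i)) (fun i => Fin (s i))
          (BornDist D o s (outerProj D ψ) M) := by
  constructor
  · intro hent
    have : Nontrivial (Fin n) := Fin.nontrivial_iff_two_le.mpr hn
    refine hent.exists_not_biseparableNS fun h0 => ?_
    simp [h0] at hψ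
  · rintro ⟨o, s, M, hM, hnot⟩ I hI hI' hprod
    exact hnot (biseparableNS_bornDist hI hI' hψ hprod o s hM)
end

section
/- For every θ ∈ (0, π/2), the generalized GHZ state |GHZ⟩ = cos θ |000⟩ + sin θ |111⟩ of three qubits is genuinely tripartite nonlocal: there exist local POVMs {M^{a_i}_{x_i}} for the three parties such that the Born-rule distribution P(a_1,a_2,a_3|x_1,x_2,x_3) = tr[(M^{a_1}_{x_1} ⊗ M^{a_2}_{x_2} ⊗ M^{a_3}_{x_3}) |GHZ⟩⟨GHZ|] admits no biseparable no-signalling decomposition. -/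
open scoped BigOperators ComplexOrder

/-- The generalized GHZ state `cos θ |000⟩ + sin θ |111⟩` of three qubits. -/
noncomputable def ghz (θ : ℝ) : (∀ _ : Fin 3, Fin 2) → ℂ :=
  fun v =>
    if v = (fun _ => 0) then (Real.cos θ : ℂ)
    else if v = (fun _ => 1) then (Real.sin θ : ℂ) else 0

open Function Finset in
/-- If a no-signalling distribution gives positive weight to `a` at settings `x`, then after
changing the setting of party `i` some outcome of party `i` has positive weight alongside the
unchanged outcomes of the others. -/
theorem NoSignalling.exists_update_pos {ι : Type} [DecidableEq ι] {A X : ι → Type}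
    [∀ i, Fintype (A i)] {J : Finset ι}
    {G : (∀ i : {j // j ∈ J}, A i.1) → (∀ i : {j // j ∈ J}, X i.1) → ℝ}
    (hG : NoSignalling (fun i : {j // j ∈ J} => A i.1) (fun i : {j // j ∈ J} => X i.1) G)
    {i : ι} (hi : i ∈ J) {a : ∀ i, A i} {x : ∀ i, X i}
    (h : 0 < G (restrictTo J a) (restrictTo J x)) (y : X i) :
    ∃ b, 0 < G (restrictTo J (update a i b)) (restrictTo J (update x i y)) := by
  have key : ∀ b, restrictTo J (update a i b) = update (restrictTo J a) ⟨i, hi⟩ b := by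
    intro b
    funext k
    by_cases hk : k = ⟨i, hi⟩
    · subst hk; simp [restrictTo]
    · have : k.1 ≠ i := fun h => hk (Subtype.ext h)
      simp [restrictTo, hk, this]
  have hns := hG.2 ⟨i, hi⟩ (restrictTo J a) (restrictTo J x) (restrictTo J (update x i y)) (by
    intro k hk
    have : k.1 ≠ i := fun h => hk (Subtype.ext h)
    simp [restrictTo, this])
  have hpos : 0 < ∑ b : A i, G (update (restrictTo J a) ⟨i, hi⟩ b) (restrictTo J x) := by
    refine Finset.sum_pos' (fun b _ => hG.1.1 _ _) ⟨a i, mem_univ _, ?_⟩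
    rwa [← key, update_eq_self]
  rw [hns] at hpos
  obtain ⟨b, -, hb⟩ := Finset.exists_lt_of_sum_lt (f := fun _ => (0 : ℝ)) (by simpa using hpos)
  exact ⟨b, by rwa [key]⟩

theorem restrictTo_update_of_notMem {ι : Type} [DecidableEq ι] {A : ι → Type} {J : Finset ι}
    {i : ι} (hi : i ∉ J) (a : ∀ i, A i) (b : A i) :
    restrictTo J (Function.update a i b) = restrictTo J a := by
  funext k
  have : k.1 ≠ i := fun h => hi (h ▸ k.2)
  simp [restrictTo, this]

open Function Finset in
/-- A product of no-signalling distributions across `(I, Iᶜ)` cannot exhibit Hardy's paradox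
between a party in `I` and a party in `Iᶜ`. -/
theorem hardy_of_separated {ι : Type} [Fintype ι] [DecidableEq ι] {A X : ι → Type}
    [∀ i, Fintype (A i)] {I : Finset ι}
    {Q : (∀ i : {j // j ∈ I}, A i.1) → (∀ i : {j // j ∈ I}, X i.1) → ℝ}
    {R : (∀ i : {j // j ∈ Iᶜ}, A i.1) → (∀ i : {j // j ∈ Iᶜ}, X i.1) → ℝ}
    (hQ : NoSignalling (fun i : {j // j ∈ I} => A i.1) (fun i : {j // j ∈ I} => X i.1) Q)
    (hR : NoSignalling (fun i : {j // j ∈ Iᶜ} => A i.1) (fun i : {j // j ∈ Iᶜ} => X i.1) R)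
    {a : ∀ i, A i} {x y : ∀ i, X i}
    (hpos : 0 < Q (restrictTo I a) (restrictTo I x) * R (restrictTo Iᶜ a) (restrictTo Iᶜ x))
    (hflip : ∀ i, ∀ b ≠ a i, Q (restrictTo I (update a i b)) (restrictTo I (update x i (y i))) *
      R (restrictTo Iᶜ (update a i b)) (restrictTo Iᶜ (update x i (y i))) = 0)
    {i j : ι} (hi : i ∈ I) (hj : j ∉ I) :
    0 < Q (restrictTo I a) (restrictTo I (update (update x i (y i)) j (y j))) *
      R (restrictTo Iᶜ a) (restrictTo Iᶜ (update (update x i (y i)) j (y j))) := by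
  have hi' : i ∉ Iᶜ := by simpa using hi
  have hj' : j ∈ Iᶜ := by simpa using hj
  have hQ0 : 0 < Q (restrictTo I a) (restrictTo I x) :=
    lt_of_le_of_ne (hQ.1.1 _ _) fun h => by simp [← h] at hpos
  have hR0 : 0 < R (restrictTo Iᶜ a) (restrictTo Iᶜ x) :=
    lt_of_le_of_ne (hR.1.1 _ _) fun h => by simp [← h] at hpos
  obtain ⟨b, hb⟩ := hQ.exists_update_pos hi hQ0 (y i)
  obtain ⟨d, hd⟩ := hR.exists_update_pos hj' hR0 (y j)
  have hb_eq : b = a i := by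
    by_contra hne
    have := hflip i b hne
    rw [restrictTo_update_of_notMem hi', restrictTo_update_of_notMem hi'] at this
    exact (mul_pos hb hR0).ne' this
  have hd_eq : d = a j := by
    by_contra hne
    have := hflip j d hne
    rw [restrictTo_update_of_notMem hj, restrictTo_update_of_notMem hj] at this
    exact (mul_pos hQ0 hd).ne' this
  subst hb_eq hd_eq
  rw [update_eq_self] at hb hd
  rw [restrictTo_update_of_notMem hj]
  by_cases hij : j = i
  · exact absurd hi (hij ▸ hj)
  · rw [update_comm (Ne.symm hij), restrictTo_update_of_notMem hi']
    exact mul_pos hb hd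

open Function Finset in
/-- Multipartite Hardy paradox: if `P` gives positive weight to `a` at settings `x`, if no party
can deviate from `a` on switching alone to its setting in `y`, and if `a` is impossible whenever
party `i₀` and one other party both switch, then `P` is not biseparable. -/
theorem not_biseparableNS_of_hardy {ι : Type} [Fintype ι] [DecidableEq ι] {A X : ι → Type}
    [∀ i, Fintype (A i)] [∀ i, Fintype (X i)] {P : (∀ i, A i) → (∀ i, X i) → ℝ}
    (a : ∀ i, A i) (x y : ∀ i, X i) (i₀ : ι) (hpos : 0 < P a x)
    (hflip : ∀ i, ∀ b ≠ a i, P (update a i b) (update x i (y i)) = 0)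
    (hpair : ∀ j ≠ i₀, P a (update (update x i₀ (y i₀)) j (y j)) = 0) :
    ¬ BiseparableNS A X P := by
  rintro ⟨p, Q, R, hp, -, hproper, hQ, hR, hP⟩
  have hzero : ∀ a x, P a x = 0 → ∀ I, p I ≠ 0 → Q I (restrictTo I a) (restrictTo I x) *
      R I (restrictTo Iᶜ a) (restrictTo Iᶜ x) = 0 := by
    intro a x h I hpI
    rw [hP, Finset.sum_eq_zero_iff_of_nonneg] at h
    · simpa [mul_assoc, hpI] using h I (mem_univ _)
    · exact fun J _ => mul_nonneg (mul_nonneg (hp J) ((hQ J).1.1 _ _)) ((hR J).1.1 _ _)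
  rw [hP] at hpos
  obtain ⟨I, -, hI⟩ := Finset.exists_lt_of_sum_lt (f := fun _ => (0 : ℝ)) (by simpa using hpos)
  have hpI : p I ≠ 0 := fun h => by simp [h] at hI
  rw [mul_assoc] at hI
  replace hI := pos_of_mul_pos_right hI (hp I)
  have hflipI := fun i b hb => hzero _ _ (hflip i b hb) I hpI
  obtain ⟨hne, huniv⟩ := hproper I hpI
  by_cases h0 : i₀ ∈ I
  · obtain ⟨j, hj⟩ : ∃ j, j ∉ I := by
      by_contra! h
      exact huniv (eq_univ_of_forall h)
    have hj0 : j ≠ i₀ := fun h => hj (h ▸ h0)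
    exact (hardy_of_separated (hQ I) (hR I) hI hflipI h0 hj).ne' (hzero _ _ (hpair j hj0) I hpI)
  · obtain ⟨j, hj⟩ := nonempty_iff_ne_empty.mpr hne
    have hj0 : j ≠ i₀ := fun h => h0 (h ▸ hj)
    have := hardy_of_separated (hQ I) (hR I) hI hflipI hj h0
    rw [update_comm hj0] at this
    exact this.ne' (hzero _ _ (hpair j hj0) I hpI)

/-- The orthogonal basis of `ℝ²` whose first vector is `(p, q)`. -/
def qubitBasis (p q : ℝ) : Fin 2 → Fin 2 → ℝ := ![![p, q], ![-q, p]]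

/-- The projective qubit measurement in the real orthogonal basis starting with `(p, q)`. -/
noncomputable def qubitMeas (p q : ℝ) (a : Fin 2) : Matrix (Fin 2) (Fin 2) ℂ :=
  Matrix.of fun k l =>
    ((qubitBasis p q a k * qubitBasis p q a l * (p ^ 2 + q ^ 2)⁻¹ : ℝ) : ℂ)

theorem isPOVM_qubitMeas {p q : ℝ} (h : p ^ 2 + q ^ 2 ≠ 0) : IsPOVM (qubitMeas p q) := by
  constructor
  · intro a
    have hvec : qubitMeas p q a = ((p ^ 2 + q ^ 2)⁻¹ : ℝ) •
        Matrix.vecMulVec (fun k => (qubitBasis p q a k : ℂ))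
          (star fun k => (qubitBasis p q a k : ℂ)) := by
      ext k l
      simp [qubitMeas, Matrix.vecMulVec_apply]
      ring
    rw [hvec]
    exact (Matrix.posSemidef_vecMulVec_self_star _).smul (by positivity)
  · ext k l
    have h' : (p : ℂ) ^ 2 + (q : ℂ) ^ 2 ≠ 0 := by exact_mod_cast h
    fin_cases k <;> fin_cases l <;> simp [qubitMeas, qubitBasis] <;> field_simp <;> ring

/-- Born rule for the generalized GHZ state and real local projective measurements. -/
theorem bornDist_ghz (θ : ℝ) (p q : Fin 3 → Fin 2 → ℝ) (a x : Fin 3 → Fin 2) :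
    BornDist (fun _ : Fin 3 => Fin 2) (fun _ => 2) (fun _ => 2)
      (outerProj (fun _ : Fin 3 => Fin 2) (ghz θ)) (fun i k => qubitMeas (p i k) (q i k)) a x =
    (Real.cos θ * ∏ i, qubitBasis (p i (x i)) (q i (x i)) (a i) 0 +
      Real.sin θ * ∏ i, qubitBasis (p i (x i)) (q i (x i)) (a i) 1) ^ 2 *
      ∏ i, (p i (x i) ^ 2 + q i (x i) ^ 2)⁻¹ := by
  have hghz : ∀ v, ghz θ v = (if v = (fun _ => 0) then (Real.cos θ : ℂ) else 0) +
      (if v = (fun _ => 1) then (Real.sin θ : ℂ) else 0) := by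
    intro v
    unfold ghz
    split_ifs with h0 h1
    · exact absurd (congrFun (h0.symm.trans h1) 0) (by decide)
    all_goals simp
  rw [← Complex.ofReal_re ((_ : ℝ) * _)]
  unfold BornDist
  congr 1
  simp only [Matrix.trace, Matrix.diag, Matrix.mul_apply, tensorOp, outerProj, Matrix.of_apply,
    hghz, map_add, mul_add, add_mul, Finset.sum_add_distrib, apply_ite (starRingEnd ℂ), map_zero,
    mul_ite, ite_mul, mul_zero, zero_mul, Finset.sum_ite_eq', Finset.mem_univ, if_true,
    Complex.conj_ofReal, Finset.sum_ite_irrel, Finset.sum_const_zero, qubitMeas,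
    Fin.prod_univ_three]
  push_cast
  ring

/-- for every `θ ∈ (0, π/2)`, the generalized GHZ state
`cos θ |000⟩ + sin θ |111⟩` is genuinely tripartite nonlocal: some Born-rule
distribution obtained from it by local POVMs admits no biseparable no-signalling
decomposition. -/
theorem ghz_genuinely_nonlocal (θ : ℝ) (hθ : θ ∈ Set.Ioo 0 (Real.pi / 2)) :
    ∃ (o s : Fin 3 → ℕ)
      (M : ∀ i : Fin 3, Fin (s i) → Fin (o i) → Matrix (Fin 2) (Fin 2) ℂ),
      (∀ i x, IsPOVM (M i x)) ∧
      ¬ BiseparableNS (fun i => Fin (o i)) (fun i => Fin (s i))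
        (BornDist (fun _ : Fin 3 => Fin 2) o s (outerProj (fun _ : Fin 3 => Fin 2) (ghz θ)) M) := by
  obtain ⟨h0, h1⟩ := hθ
  have hs : 0 < Real.sin θ := Real.sin_pos_of_pos_of_lt_pi h0 (by linarith)
  have hc : 0 < Real.cos θ := Real.cos_pos_of_mem_Ioo ⟨by linarith, h1⟩
  set s := Real.sin θ with hs_def
  set c := Real.cos θ with hc_def
  let p : Fin 3 → Fin 2 → ℝ := ![![16 * c, s], ![s, 8 * c], ![s, 8 * c]]
  let q : Fin 3 → Fin 2 → ℝ := ![![-s, 4 * c], ![2 * c, -s], ![2 * c, -s]]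
  refine ⟨fun _ => 2, fun _ => 2, fun i k => qubitMeas (p i k) (q i k), ?_, ?_⟩
  · intro i k
    apply isPOVM_qubitMeas
    fin_cases i <;> fin_cases k <;> simp [p, q] <;> positivity
  · refine not_biseparableNS_of_hardy (fun _ => 0) (fun _ => 0) (fun _ => 1) 0 ?_ ?_ ?_
    · rw [bornDist_ghz]
      simp [Fin.prod_univ_three, p, q, qubitBasis, ← hs_def, ← hc_def]
      have : c * (16 * c * s * s) + -(s * (s * (2 * c) * (2 * c))) = 12 * c ^ 2 * s ^ 2 := by ring
      rw [this]
      positivity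
    · intro i b hb
      obtain rfl : b = 1 := Fin.eq_one_of_ne_zero b hb
      rw [bornDist_ghz]
      fin_cases i <;> simp [Fin.prod_univ_three, p, q, qubitBasis, ← hs_def, ← hc_def] <;>
        left <;> ring
    · intro j hj
      rw [bornDist_ghz]
      fin_cases j <;> simp [Fin.prod_univ_three, p, q, qubitBasis, ← hs_def, ← hc_def] at hj ⊢ <;>
        left <;> ring
end

section
/- Let |GHZ⟩ = cos θ |000⟩_{ABC} + sin θ |111⟩_{ABC} with θ ∈ (0, π/2), and take two copies |GHZ⟩_{ABC} ⊗ |GHZ⟩_{ÂB̂Ĉ}. There exist rank-one projective measurements on qubits B and B̂ and a four-outcome projective joint measurement on the pair of qubits C, Ĉ such that for exactly one half of all measurement-outcome combinations (b, b̂, cĉ), the normalized post-measurement state of the qubits A and Â is a maximally entangled two-qubit state; moreover this holds for every θ ∈ (0, π/2). -/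
open scoped BigOperators ComplexOrder

/-- The (unnormalized) conditional state of the qubits `A, Â` after the rank-one
projective outcomes `|β_b⟩` on `B`, `|βh_bh⟩` on `B̂` and `|λ_c⟩` on the pair `C, Ĉ`
are obtained on the two copies `|ψ⟩_{ABC} ⊗ |ψ⟩_{ÂB̂Ĉ}`; party order in `ψ` is
`(A, B, C)`. -/
noncomputable def swappedState (ψ : (∀ _ : Fin 3, Fin 2) → ℂ)
    (β βh : Fin 2 → Fin 2 → ℂ) (lam : Fin 4 → Fin 2 × Fin 2 → ℂ)
    (b bh : Fin 2) (c : Fin 4) : Fin 2 → Fin 2 → ℂ :=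
  fun a ah =>
    ∑ bq : Fin 2, ∑ bhq : Fin 2, ∑ cq : Fin 2, ∑ chq : Fin 2,
      (starRingEnd ℂ) (β b bq) * (starRingEnd ℂ) (βh bh bhq) *
        (starRingEnd ℂ) (lam c (cq, chq)) * ψ ![a, bq, cq] * ψ ![ah, bhq, chq]

/-- An orthonormal family of vectors (rank-one projective measurement). -/
def OrthonormalFamily {o d : Type} [Fintype d] [DecidableEq o] (β : o → d → ℂ) : Prop :=
  ∀ b b', (∑ q, (starRingEnd ℂ) (β b q) * β b' q) = if b = b' then 1 else 0

/-- A nonzero two-qubit vector is (proportional to) a maximally entangled state: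
both reduced density matrices of the normalized state equal `1/2 · Identity`. -/
def IsMaxEntangled (φ : Fin 2 → Fin 2 → ℂ) : Prop :=
  φ ≠ 0 ∧
    (∀ a a', (∑ ah : Fin 2, φ a ah * (starRingEnd ℂ) (φ a' ah)) =
      if a = a' then ((∑ u : Fin 2, ∑ w : Fin 2, Complex.normSq (φ u w)) / 2 : ℝ) else 0) ∧
    (∀ ah ah', (∑ a : Fin 2, φ a ah * (starRingEnd ℂ) (φ a ah')) =
      if ah = ah' then ((∑ u : Fin 2, ∑ w : Fin 2, Complex.normSq (φ u w)) / 2 : ℝ) else 0)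

/-- On two generalized GHZ states the measured qubits are copies of `A` and `Â`, so the conditional
state is an entrywise product. -/
lemma swappedState_ghz (θ : ℝ) (β βh : Fin 2 → Fin 2 → ℂ) (lam : Fin 4 → Fin 2 × Fin 2 → ℂ)
    (b bh : Fin 2) (c : Fin 4) (a ah : Fin 2) :
    swappedState (ghz θ) β βh lam b bh c a ah =
      (starRingEnd ℂ) (β b a) * (starRingEnd ℂ) (βh bh ah) * (starRingEnd ℂ) (lam c (a, ah)) *
        ((![Real.cos θ, Real.sin θ] a : ℝ) : ℂ) * ((![Real.cos θ, Real.sin θ] ah : ℝ) : ℂ) := by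
  fin_cases a <;> fin_cases ah <;>
    simp [swappedState, ghz, funext_iff, Fin.forall_fin_succ, Fin.sum_univ_two]

/-- An antidiagonal two-qubit vector with entries of equal nonzero modulus is maximally
entangled. -/
lemma isMaxEntangled_of_antidiagonal {φ : Fin 2 → Fin 2 → ℂ} (h00 : φ 0 0 = 0) (h11 : φ 1 1 = 0)
    (hmod : Complex.normSq (φ 0 1) = Complex.normSq (φ 1 0)) (hne : φ 0 1 ≠ 0) :
    IsMaxEntangled φ := by
  refine ⟨fun h => hne (by simp [h]), ?_, ?_⟩ <;> intro a a' <;>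
    fin_cases a <;> fin_cases a' <;>
    simp [Fin.sum_univ_two, h00, h11, hmod, Complex.mul_conj]

/-- A two-qubit vector with a vanishing row is not maximally entangled. -/
lemma not_isMaxEntangled_of_row_eq_zero {φ : Fin 2 → Fin 2 → ℂ} (a : Fin 2)
    (h : ∀ ah, φ a ah = 0) : ¬ IsMaxEntangled φ := by
  rintro ⟨hne, hrow, -⟩
  have hsum : (∑ u : Fin 2, ∑ w : Fin 2, Complex.normSq (φ u w)) / 2 = 0 := by
    have := hrow a a
    simp only [h, zero_mul, Finset.sum_const_zero, if_true] at this
    exact_mod_cast this.symm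
  refine hne (funext fun u => funext fun w => ?_)
  have hnonneg (u w : Fin 2) : 0 ≤ Complex.normSq (φ u w) := Complex.normSq_nonneg _
  have hsum' : ∑ u : Fin 2, ∑ w : Fin 2, Complex.normSq (φ u w) = 0 := by linarith
  rw [Finset.sum_eq_zero_iff_of_nonneg fun u _ => Finset.sum_nonneg fun w _ => hnonneg u w]
    at hsum'
  have hu := hsum' u (Finset.mem_univ u)
  rw [Finset.sum_eq_zero_iff_of_nonneg fun w _ => hnonneg u w] at hu
  exact Complex.normSq_eq_zero.mp (hu w (Finset.mem_univ w))

/-- A complex number of squared modulus `1/2`, used as normalization in place of `1/√2`. -/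
noncomputable def halfUnit : ℂ := (1 + Complex.I) / 2

lemma normSq_halfUnit : Complex.normSq halfUnit = 1 / 2 := by
  norm_num [halfUnit, Complex.normSq_apply]

lemma conj_halfUnit_mul_halfUnit : (starRingEnd ℂ) halfUnit * halfUnit = 1 / 2 := by
  rw [mul_comm, Complex.mul_conj, normSq_halfUnit]
  norm_num

lemma halfUnit_ne_zero : halfUnit ≠ 0 := by
  rw [← Complex.normSq_pos, normSq_halfUnit]
  norm_num

/-- The Hadamard basis `|±⟩`, up to a phase. -/
noncomputable def hadamardBasis (b q : Fin 2) : ℂ :=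
  !![halfUnit, halfUnit; halfUnit, -halfUnit] b q

/-- The basis `|Ψ⁺⟩, |Ψ⁻⟩, |00⟩, |11⟩` of two qubits, up to phases. -/
noncomputable def partialBellBasis (c : Fin 4) (p : Fin 2 × Fin 2) : ℂ :=
  ![!![0, halfUnit; halfUnit, 0], !![0, halfUnit; -halfUnit, 0], !![1, 0; 0, 0],
    !![0, 0; 0, 1]] c p.1 p.2

lemma orthonormalFamily_hadamardBasis : OrthonormalFamily hadamardBasis := by
  intro b b'
  fin_cases b <;> fin_cases b' <;>
    norm_num [hadamardBasis, Fin.sum_univ_two, conj_halfUnit_mul_halfUnit]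

lemma orthonormalFamily_partialBellBasis : OrthonormalFamily partialBellBasis := by
  intro c c'
  fin_cases c <;> fin_cases c' <;>
    norm_num [partialBellBasis, Fintype.sum_prod_type, Fin.sum_univ_two,
      conj_halfUnit_mul_halfUnit]

lemma normSq_hadamardBasis (b q : Fin 2) : Complex.normSq (hadamardBasis b q) = 1 / 2 := by
  fin_cases b <;> fin_cases q <;> simp [hadamardBasis, normSq_halfUnit]

lemma hadamardBasis_ne_zero (b q : Fin 2) : hadamardBasis b q ≠ 0 := by
  rw [← Complex.normSq_pos, normSq_hadamardBasis]
  norm_num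

/-- The outcomes leaving `A, Â` maximally entangled are those with `C, Ĉ` found in `|Ψ^±⟩`. -/
lemma isMaxEntangled_swappedState_ghz_iff {θ : ℝ} (hθ : θ ∈ Set.Ioo 0 (Real.pi / 2))
    (b bh : Fin 2) (c : Fin 4) :
    IsMaxEntangled (swappedState (ghz θ) hadamardBasis hadamardBasis partialBellBasis b bh c) ↔
      c < 2 := by
  have hcos : (Real.cos θ : ℂ) ≠ 0 := by
    exact_mod_cast (Real.cos_pos_of_mem_Ioo ⟨by linarith [hθ.1, Real.pi_pos], hθ.2⟩).ne'
  have hsin : (Real.sin θ : ℂ) ≠ 0 := by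
    exact_mod_cast (Real.sin_pos_of_pos_of_lt_pi hθ.1 (by linarith [hθ.2, Real.pi_pos])).ne'
  have hpsi {c : Fin 4} (h00 : partialBellBasis c (0, 0) = 0)
      (h11 : partialBellBasis c (1, 1) = 0)
      (h01 : Complex.normSq (partialBellBasis c (0, 1)) = 1 / 2)
      (h10 : Complex.normSq (partialBellBasis c (1, 0)) = 1 / 2) :
      IsMaxEntangled
        (swappedState (ghz θ) hadamardBasis hadamardBasis partialBellBasis b bh c) := by
    have hne : partialBellBasis c (0, 1) ≠ 0 := by
      rw [← Complex.normSq_pos, h01]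
      norm_num
    apply isMaxEntangled_of_antidiagonal
    · simp [swappedState_ghz, h00]
    · simp [swappedState_ghz, h11]
    · simp only [swappedState_ghz, map_mul, Complex.normSq_conj, normSq_hadamardBasis, h01, h10]
      ring
    · simpa [swappedState_ghz, hadamardBasis_ne_zero, hne] using And.intro hcos hsin
  fin_cases c
  · exact iff_of_true (hpsi (by simp [partialBellBasis]) (by simp [partialBellBasis])
      (by simp [partialBellBasis, normSq_halfUnit])
      (by simp [partialBellBasis, normSq_halfUnit])) (by decide)
  · exact iff_of_true (hpsi (by simp [partialBellBasis]) (by simp [partialBellBasis])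
      (by simp [partialBellBasis, normSq_halfUnit])
      (by simp [partialBellBasis, normSq_halfUnit])) (by decide)
  · refine iff_of_false (not_isMaxEntangled_of_row_eq_zero 1 fun ah => ?_) (by decide)
    fin_cases ah <;> simp [swappedState_ghz, partialBellBasis]
  · refine iff_of_false (not_isMaxEntangled_of_row_eq_zero 0 fun ah => ?_) (by decide)
    fin_cases ah <;> simp [swappedState_ghz, partialBellBasis]

/-- for the generalized GHZ states `cos θ |000⟩ + sin θ |111⟩`, there
exist rank-one projective measurements on `B` and `B̂` and a four-outcome projective
joint measurement on the pair `C, Ĉ` (independent of `θ`) such that, for every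
`θ ∈ (0, π/2)`, exactly one half of all 16 measurement-outcome combinations
`(b, bh, cĉ)` occur with nonzero probability and leave the qubits `A, Â` in a
maximally entangled post-measurement state. -/
theorem ghz_entanglement_swapping :
    ∃ (β βh : Fin 2 → Fin 2 → ℂ) (lam : Fin 4 → Fin 2 × Fin 2 → ℂ),
      OrthonormalFamily β ∧ OrthonormalFamily βh ∧ OrthonormalFamily lam ∧
      ∀ θ ∈ Set.Ioo 0 (Real.pi / 2),
        Set.ncard {z : Fin 2 × Fin 2 × Fin 4 |
          IsMaxEntangled (swappedState (ghz θ) β βh lam z.1 z.2.1 z.2.2)} = 8 := by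
  refine ⟨hadamardBasis, hadamardBasis, partialBellBasis, orthonormalFamily_hadamardBasis,
    orthonormalFamily_hadamardBasis, orthonormalFamily_partialBellBasis, fun θ hθ => ?_⟩
  simp only [isMaxEntangled_swappedState_ghz_iff hθ]
  rw [Set.ncard_eq_toFinset_card']
  decide
end

section
/- Consider the triangle network state |T⟩ = |Φ⁺⟩_{A_2 B_1} ⊗ |Φ⁺⟩_{B_2 C_1} ⊗ |Φ⁺⟩_{C_2 A_2'}, where |Φ⁺⟩ = (|00⟩+|11⟩)/√2, and the three parties are A = (A_1=C_2-side qubit, A_2), B = (B_1, B_2), C = (C_1, C_2), i.e., each of the three parties holds two qubits coming from two different EPR pairs arranged in a triangle. Then |T⟩, viewed as a tripartite pure state with each party's Hilbert space being the four-dimensional space of its two qubits, is genuinely tripartite entangled (not a product across any bipartition of {A,B,C}), and it is genuinely tripartite nonlocal: there exist local POVMs with four outcomes per party such that the resulting Born-rule distribution admits no biseparable no-signalling decomposition. -/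
open scoped BigOperators ComplexOrder

/-- The amplitude of the two-qubit EPR state `|Φ⁺⟩ = (|00⟩ + |11⟩)/√2`. -/
noncomputable def eprAmp (x y : Fin 2) : ℂ :=
  if x = y then ((Real.sqrt 2)⁻¹ : ℂ) else 0

/-- The triangle-network state: three EPR pairs `(A₂B₁), (B₂C₁), (C₂A₁)` arranged in a
triangle, viewed as a tripartite state where each party `A = (A₁,A₂)`, `B = (B₁,B₂)`,
`C = (C₁,C₂)` holds the four-dimensional space of its two qubits.  Party `i`'s index is
a pair `(first qubit, second qubit)`. -/
noncomputable def triangleState : (∀ _ : Fin 3, Fin 2 × Fin 2) → ℂ :=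
  fun v =>
    eprAmp (v 0).2 (v 1).1 * eprAmp (v 1).2 (v 2).1 * eprAmp (v 2).2 (v 0).1

open scoped Kronecker

section Factorization

variable {ι : Type} [Fintype ι] [DecidableEq ι] {A : ι → Type}

theorem restrictTo_prod_bijective (I : Finset ι) :
    Function.Bijective fun a : ∀ i, A i => (restrictTo I a, restrictTo Iᶜ a) := by
  constructor
  · intro a b h
    obtain ⟨h₁, h₂⟩ := Prod.mk.inj h
    funext i
    by_cases hi : i ∈ I
    · exact congrFun h₁ ⟨i, hi⟩
    · exact congrFun h₂ ⟨i, Finset.mem_compl.2 hi⟩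
  · rintro ⟨u, v⟩
    refine ⟨fun i => if hi : i ∈ I then u ⟨i, hi⟩ else v ⟨i, Finset.mem_compl.2 hi⟩, ?_⟩
    refine Prod.ext (funext fun i => ?_) (funext fun i => ?_)
    · simp [restrictTo]
    · simp [restrictTo, Finset.mem_compl.1 i.2]

theorem sum_restrictTo_mul [∀ i, Fintype (A i)] (I : Finset ι)
    (F : (∀ i : {j // j ∈ I}, A i.1) → ℝ) (G : (∀ i : {j // j ∈ Iᶜ}, A i.1) → ℝ) :
    ∑ a, F (restrictTo I a) * G (restrictTo Iᶜ a) = (∑ u, F u) * ∑ v, G v := by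
  rw [Finset.sum_mul_sum, ← Fintype.sum_prod_type']
  exact Fintype.sum_bijective _ (restrictTo_prod_bijective I) _ _ fun _ => rfl

end Factorization

theorem abs_sum_mul_le_one {α : Type} [Fintype α] {f p : α → ℝ} (hf : ∀ a, |f a| ≤ 1)
    (hp : ∀ a, 0 ≤ p a) (hsum : ∑ a, p a = 1) : |∑ a, f a * p a| ≤ 1 := by
  rw [← hsum]
  refine (Finset.abs_sum_le_sum_abs _ _).trans (Finset.sum_le_sum fun a _ => ?_)
  rw [abs_mul, abs_of_nonneg (hp a)]
  exact mul_le_of_le_one_left (hp a) (hf a)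

theorem chsh_local_bound {a₀ a₁ b₀ b₁ : ℝ} (ha₀ : |a₀| ≤ 1) (ha₁ : |a₁| ≤ 1) (hb₀ : |b₀| ≤ 1)
    (hb₁ : |b₁| ≤ 1) : a₀ * b₀ + a₀ * b₁ + a₁ * b₀ - a₁ * b₁ ≤ 2 := by
  have h₀ : a₀ * (b₀ + b₁) ≤ |b₀ + b₁| := (le_abs_self _).trans <| by
    rw [abs_mul]; exact mul_le_of_le_one_left (abs_nonneg _) ha₀
  have h₁ : a₁ * (b₀ - b₁) ≤ |b₀ - b₁| := (le_abs_self _).trans <| by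
    rw [abs_mul]; exact mul_le_of_le_one_left (abs_nonneg _) ha₁
  rw [abs_le] at hb₀ hb₁
  have : |b₀ + b₁| + |b₀ - b₁| ≤ 2 := by
    rcases abs_cases (b₀ + b₁) with h | h <;> rcases abs_cases (b₀ - b₁) with h' | h' <;> linarith
  linarith

/-- The `±1` value assigned to the measurement of the first qubit by a four-valued outcome. -/
def firstSign : Fin 4 → ℝ := ![1, 1, -1, -1]

/-- The `±1` value assigned to the measurement of the second qubit by a four-valued outcome. -/
def secondSign : Fin 4 → ℝ := ![1, -1, 1, -1]

theorem abs_firstSign (a : Fin 4) : |firstSign a| = 1 := by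
  fin_cases a <;> simp [firstSign]

theorem abs_secondSign (a : Fin 4) : |secondSign a| = 1 := by
  fin_cases a <;> simp [secondSign]

/-- Parties `k` and `k + 1` use the settings `x` and `y`, the remaining party uses `0`. -/
def linkSetting (k : Fin 3) (x y : Fin 2) : Fin 3 → Fin 2 :=
  fun m => if m = k then x else if m = k + 1 then y else 0

/-- The correlator of the second bit of party `k` with the first bit of party `k + 1`. -/
noncomputable def linkCorrelator (P : (Fin 3 → Fin 4) → (Fin 3 → Fin 2) → ℝ) (k : Fin 3)
    (x y : Fin 2) : ℝ :=
  ∑ a, secondSign (a k) * firstSign (a (k + 1)) * P a (linkSetting k x y)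

/-- The CHSH value of the link between parties `k` and `k + 1`. -/
noncomputable def linkCHSH (P : (Fin 3 → Fin 4) → (Fin 3 → Fin 2) → ℝ) (k : Fin 3) : ℝ :=
  linkCorrelator P k 0 0 + linkCorrelator P k 0 1 + linkCorrelator P k 1 0 - linkCorrelator P k 1 1

theorem linkCHSH_sum {κ : Type} [Fintype κ] (p : κ → ℝ)
    (W : κ → (Fin 3 → Fin 4) → (Fin 3 → Fin 2) → ℝ) (k : Fin 3) :
    linkCHSH (fun a x => ∑ I, p I * W I a x) k = ∑ I, p I * linkCHSH (W I) k := by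
  have h (x y : Fin 2) : linkCorrelator (fun a x => ∑ I, p I * W I a x) k x y =
      ∑ I, p I * linkCorrelator (W I) k x y := by
    simp only [linkCorrelator, Finset.mul_sum]
    rw [Finset.sum_comm]
    exact Finset.sum_congr rfl fun _ _ => Finset.sum_congr rfl fun _ _ => by ring
  simp only [linkCHSH, h, mul_add, mul_sub, Finset.sum_add_distrib, Finset.sum_sub_distrib]

section Product

variable {I : Finset (Fin 3)}
  {Q : ({j // j ∈ I} → Fin 4) → ({j // j ∈ I} → Fin 2) → ℝ}
  {R : ({j // j ∈ Iᶜ} → Fin 4) → ({j // j ∈ Iᶜ} → Fin 2) → ℝ}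

/-- The product distribution across the bipartition `(I, Iᶜ)`. -/
def bipartiteProduct (Q : ({j // j ∈ I} → Fin 4) → ({j // j ∈ I} → Fin 2) → ℝ)
    (R : ({j // j ∈ Iᶜ} → Fin 4) → ({j // j ∈ Iᶜ} → Fin 2) → ℝ)
    (a : Fin 3 → Fin 4) (x : Fin 3 → Fin 2) : ℝ :=
  Q (restrictTo I a) (restrictTo I x) * R (restrictTo Iᶜ a) (restrictTo Iᶜ x)

theorem abs_linkCorrelator_le (hQ : IsCondDist (fun _ => Fin 4) (fun _ => Fin 2) Q)
    (hR : IsCondDist (fun _ => Fin 4) (fun _ => Fin 2) R) (k : Fin 3) (x y : Fin 2) :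
    |linkCorrelator (bipartiteProduct Q R) k x y| ≤ 1 := by
  refine abs_sum_mul_le_one (fun a => ?_) (fun a => mul_nonneg (hQ.1 _ _) (hR.1 _ _)) ?_
  · rw [abs_mul, abs_firstSign, abs_secondSign, one_mul]
  · exact (sum_restrictTo_mul (A := fun _ => Fin 4) I (fun u => Q u (restrictTo I (linkSetting k x y)))
      (fun v => R v (restrictTo Iᶜ (linkSetting k x y)))).trans (by rw [hQ.2, hR.2, one_mul])

theorem linkCHSH_le_four (hQ : IsCondDist (fun _ => Fin 4) (fun _ => Fin 2) Q)
    (hR : IsCondDist (fun _ => Fin 4) (fun _ => Fin 2) R) (k : Fin 3) :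
    linkCHSH (bipartiteProduct Q R) k ≤ 4 := by
  have h := fun x y => abs_le.1 (abs_linkCorrelator_le hQ hR k x y)
  have h₁ := h 0 0
  have h₂ := h 0 1
  have h₃ := h 1 0
  have h₄ := h 1 1
  unfold linkCHSH
  linarith

theorem linkCHSH_le_two_of_mem (hQ : IsCondDist (fun _ => Fin 4) (fun _ => Fin 2) Q)
    (hR : IsCondDist (fun _ => Fin 4) (fun _ => Fin 2) R) {k : Fin 3} (hk : k ∈ I)
    (hk' : k + 1 ∉ I) : linkCHSH (bipartiteProduct Q R) k ≤ 2 := by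
  have hk'' : k + 1 ∈ Iᶜ := Finset.mem_compl.2 hk'
  let α (x : Fin 2) : ℝ := ∑ u : {j // j ∈ I} → Fin 4,
    secondSign (u ⟨k, hk⟩) * Q u (restrictTo I (linkSetting k x 0))
  let β (y : Fin 2) : ℝ := ∑ v : {j // j ∈ Iᶜ} → Fin 4,
    firstSign (v ⟨k + 1, hk''⟩) * R v (restrictTo Iᶜ (linkSetting k 0 y))
  have hα (x : Fin 2) : |α x| ≤ 1 :=
    abs_sum_mul_le_one (fun u => (abs_secondSign _).le) (fun u => hQ.1 _ _) (hQ.2 _)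
  have hβ (y : Fin 2) : |β y| ≤ 1 :=
    abs_sum_mul_le_one (fun v => (abs_firstSign _).le) (fun v => hR.1 _ _) (hR.2 _)
  have hE (x y : Fin 2) : linkCorrelator (bipartiteProduct Q R) k x y = α x * β y := by
    have hx : restrictTo I (linkSetting k x y) = restrictTo I (linkSetting k x 0) := by
      funext m
      have : m.1 ≠ k + 1 := fun h => hk' (h ▸ m.2)
      simp [restrictTo, linkSetting, this]
    have hy : restrictTo Iᶜ (linkSetting k x y) = restrictTo Iᶜ (linkSetting k 0 y) := by
      funext m
      have : m.1 ≠ k := fun h => Finset.mem_compl.1 m.2 (h ▸ hk)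
      simp [restrictTo, linkSetting, this]
    refine Eq.trans ?_ (sum_restrictTo_mul (A := fun _ => Fin 4) I
      (fun u => secondSign (u ⟨k, hk⟩) * Q u (restrictTo I (linkSetting k x 0)))
      (fun v => firstSign (v ⟨k + 1, hk''⟩) * R v (restrictTo Iᶜ (linkSetting k 0 y))))
    refine Finset.sum_congr rfl fun a _ => ?_
    simp only [bipartiteProduct, hx, hy]
    simp only [restrictTo]
    ring
  simp only [linkCHSH, hE]
  exact chsh_local_bound (hα 0) (hα 1) (hβ 0) (hβ 1)

theorem linkCHSH_le_two_of_not_mem (hQ : IsCondDist (fun _ => Fin 4) (fun _ => Fin 2) Q)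
    (hR : IsCondDist (fun _ => Fin 4) (fun _ => Fin 2) R) {k : Fin 3} (hk : k ∉ I)
    (hk' : k + 1 ∈ I) : linkCHSH (bipartiteProduct Q R) k ≤ 2 := by
  have hk'' : k ∈ Iᶜ := Finset.mem_compl.2 hk
  let α (x : Fin 2) : ℝ := ∑ v : {j // j ∈ Iᶜ} → Fin 4,
    secondSign (v ⟨k, hk''⟩) * R v (restrictTo Iᶜ (linkSetting k x 0))
  let β (y : Fin 2) : ℝ := ∑ u : {j // j ∈ I} → Fin 4,
    firstSign (u ⟨k + 1, hk'⟩) * Q u (restrictTo I (linkSetting k 0 y))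
  have hα (x : Fin 2) : |α x| ≤ 1 :=
    abs_sum_mul_le_one (fun v => (abs_secondSign _).le) (fun v => hR.1 _ _) (hR.2 _)
  have hβ (y : Fin 2) : |β y| ≤ 1 :=
    abs_sum_mul_le_one (fun u => (abs_firstSign _).le) (fun u => hQ.1 _ _) (hQ.2 _)
  have hE (x y : Fin 2) : linkCorrelator (bipartiteProduct Q R) k x y = α x * β y := by
    have hx : restrictTo Iᶜ (linkSetting k x y) = restrictTo Iᶜ (linkSetting k x 0) := by
      funext m
      have : m.1 ≠ k + 1 := fun h => Finset.mem_compl.1 m.2 (h ▸ hk')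
      simp [restrictTo, linkSetting, this]
    have hy : restrictTo I (linkSetting k x y) = restrictTo I (linkSetting k 0 y) := by
      funext m
      have : m.1 ≠ k := fun h => hk (h ▸ m.2)
      simp [restrictTo, linkSetting, this]
    rw [mul_comm]
    refine Eq.trans ?_ (sum_restrictTo_mul (A := fun _ => Fin 4) I
      (fun u => firstSign (u ⟨k + 1, hk'⟩) * Q u (restrictTo I (linkSetting k 0 y)))
      (fun v => secondSign (v ⟨k, hk''⟩) * R v (restrictTo Iᶜ (linkSetting k x 0))))
    refine Finset.sum_congr rfl fun a _ => ?_
    simp only [bipartiteProduct, hx, hy]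
    simp only [restrictTo]
    ring
  simp only [linkCHSH, hE]
  exact chsh_local_bound (hα 0) (hα 1) (hβ 0) (hβ 1)

/-- Every nontrivial bipartition of the triangle cuts two links, so that at most one of the three
links exceeds the local CHSH bound. -/
theorem sum_linkCHSH_le (hQ : IsCondDist (fun _ => Fin 4) (fun _ => Fin 2) Q)
    (hR : IsCondDist (fun _ => Fin 4) (fun _ => Fin 2) R) (hI : I ≠ ∅) (hI' : I ≠ Finset.univ) :
    ∑ k, linkCHSH (bipartiteProduct Q R) k ≤ 8 := by
  have hk (k : Fin 3) : linkCHSH (bipartiteProduct Q R) k ≤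
      ((if (k ∈ I ↔ k + 1 ∈ I) then 4 else 2 : ℕ) : ℝ) := by
    by_cases h : k ∈ I <;> by_cases h' : k + 1 ∈ I <;> simp only [h, h'] <;> norm_num
    · exact linkCHSH_le_four hQ hR k
    · exact linkCHSH_le_two_of_mem hQ hR h h'
    · exact linkCHSH_le_two_of_not_mem hQ hR h h'
    · exact linkCHSH_le_four hQ hR k
  have hcut : ∀ J : Finset (Fin 3), J ≠ ∅ → J ≠ Finset.univ →
      ∑ k, (if (k ∈ J ↔ k + 1 ∈ J) then 4 else 2) ≤ 8 := by decide
  refine (Finset.sum_le_sum fun k _ => hk k).trans ?_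
  exact_mod_cast hcut I hI hI'

end Product

theorem sum_linkCHSH_le_of_biseparableNS {P : (Fin 3 → Fin 4) → (Fin 3 → Fin 2) → ℝ}
    (h : BiseparableNS (fun _ : Fin 3 => Fin 4) (fun _ => Fin 2) P) :
    ∑ k, linkCHSH P k ≤ 8 := by
  obtain ⟨p, Q, R, hp, hsum, hne, hQ, hR, hP⟩ := h
  have hP' : P = fun a x => ∑ I, p I * bipartiteProduct (Q I) (R I) a x := by
    funext a x
    rw [hP]
    exact Finset.sum_congr rfl fun I _ => mul_assoc _ _ _
  calc ∑ k, linkCHSH P k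
      = ∑ I, p I * ∑ k, linkCHSH (bipartiteProduct (Q I) (R I)) k := by
        simp only [hP', linkCHSH_sum, Finset.mul_sum]
        exact Finset.sum_comm
    _ ≤ ∑ I, p I * 8 := by
        refine Finset.sum_le_sum fun I _ => ?_
        by_cases hI : p I = 0
        · simp [hI]
        · exact mul_le_mul_of_nonneg_left
            (sum_linkCHSH_le (hQ I).1 (hR I).1 (hne I hI).1 (hne I hI).2) (hp I)
    _ = 8 := by rw [← Finset.sum_mul, hsum, one_mul]

/-- The operator `(1 + c Z + s X) / 2`, a rank-one projector when `c ^ 2 + s ^ 2 = 1`. -/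
noncomputable def qubitProj (c s : ℝ) : Matrix (Fin 2) (Fin 2) ℂ :=
  !![(((1 + c) / 2 : ℝ) : ℂ), ((s / 2 : ℝ) : ℂ); ((s / 2 : ℝ) : ℂ), (((1 - c) / 2 : ℝ) : ℂ)]

theorem qubitProj_posSemidef {c s : ℝ} (h : c ^ 2 + s ^ 2 = 1) : (qubitProj c s).PosSemidef := by
  have hmul : (qubitProj c s).conjTranspose * qubitProj c s = qubitProj c s := by
    ext i j
    fin_cases i <;> fin_cases j <;>
      simp only [qubitProj, Matrix.mul_apply, Fin.sum_univ_two, Matrix.conjTranspose_apply,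
        Matrix.of_apply, Matrix.cons_val', Matrix.cons_val_zero, Matrix.cons_val_one,
        Matrix.cons_val_fin_one, Fin.zero_eta, Fin.mk_one, Complex.star_def,
        Complex.conj_ofReal, ← Complex.ofReal_mul, ← Complex.ofReal_add, Complex.ofReal_inj] <;>
      first | ring1 | linear_combination h / 4
  rw [← hmul]
  exact Matrix.posSemidef_conjTranspose_mul_self _

/-- The `Z` and `X` components of the observable measured on the first qubit. -/
noncomputable def firstDir : Fin 2 → ℝ × ℝ := ![(4 / 5, 3 / 5), (4 / 5, -3 / 5)]

/-- The `Z` and `X` components of the observable measured on the second qubit. -/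
noncomputable def secondDir : Fin 2 → ℝ × ℝ := ![(1, 0), (0, 1)]

/-- The effect of outcome `a` on the first qubit, for setting `x`. -/
noncomputable def firstEffect (x : Fin 2) (a : Fin 4) : Matrix (Fin 2) (Fin 2) ℂ :=
  qubitProj (firstSign a * (firstDir x).1) (firstSign a * (firstDir x).2)

/-- The effect of outcome `a` on the second qubit, for setting `x`. -/
noncomputable def secondEffect (x : Fin 2) (a : Fin 4) : Matrix (Fin 2) (Fin 2) ℂ :=
  qubitProj (secondSign a * (secondDir x).1) (secondSign a * (secondDir x).2)

/-- Each party measures its two qubits separately, both with the setting `x`. -/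
noncomputable def linkPOVM (x : Fin 2) (a : Fin 4) : Matrix (Fin 2 × Fin 2) (Fin 2 × Fin 2) ℂ :=
  firstEffect x a ⊗ₖ secondEffect x a

theorem linkPOVM_isPOVM (x : Fin 2) : IsPOVM (linkPOVM x) := by
  refine ⟨fun a => Matrix.PosSemidef.kronecker ?_ ?_, ?_⟩
  · refine qubitProj_posSemidef ?_
    fin_cases a <;> fin_cases x <;> norm_num [firstSign, firstDir]
  · refine qubitProj_posSemidef ?_
    fin_cases a <;> fin_cases x <;> norm_num [secondSign, secondDir]
  · have hadd (c s : ℝ) : qubitProj c s + qubitProj (-c) (-s) = 1 := by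
      ext i j
      fin_cases i <;> fin_cases j <;> simp [qubitProj] <;> ring
    simp only [Fin.sum_univ_four, linkPOVM, firstEffect, secondEffect]
    simp only [firstSign, secondSign, Matrix.cons_val, one_mul, neg_one_mul]
    rw [← Matrix.kronecker_add, add_assoc, ← Matrix.kronecker_add, hadd, ← Matrix.add_kronecker,
      hadd, Matrix.one_kronecker_one]

/-- A function on `Fin 3` as a triple. -/
def finThreeArrowEquiv (α : Type) : (Fin 3 → α) ≃ α × α × α where
  toFun v := (v 0, v 1, v 2)
  invFun p := ![p.1, p.2.1, p.2.2]
  left_inv v := by funext i; fin_cases i <;> rfl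
  right_inv _ := rfl

theorem sum_finThreeArrow {α M : Type} [Fintype α] [AddCommMonoid M] (F : (Fin 3 → α) → M) :
    ∑ v, F v = ∑ a, ∑ b, ∑ c, F ![a, b, c] := by
  rw [← (finThreeArrowEquiv α).symm.sum_comp, Fintype.sum_prod_type]
  simp only [Fintype.sum_prod_type]
  rfl

theorem conj_triangleState (v : Fin 3 → Fin 2 × Fin 2) :
    starRingEnd ℂ (triangleState v) = triangleState v := by
  simp [triangleState, eprAmp, apply_ite (starRingEnd ℂ)]

theorem sum_mul_triangleState (F : (Fin 3 → Fin 2 × Fin 2) → ℂ) :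
    ∑ v, F v * triangleState v =
      ((Real.sqrt 2 : ℝ) : ℂ)⁻¹ ^ 3 * ∑ p, ∑ q, ∑ r, F ![(r, p), (p, q), (q, r)] := by
  rw [sum_finThreeArrow]
  simp only [Fintype.sum_prod_type, triangleState, eprAmp, Matrix.cons_val, Fin.sum_univ_two]
  norm_num
  ring

theorem trace_tensorOp_triangleState (K L : Fin 3 → Matrix (Fin 2) (Fin 2) ℂ) :
    Matrix.trace (tensorOp (fun _ : Fin 3 => Fin 2 × Fin 2) (fun i => K i ⊗ₖ L i) *
      outerProj (fun _ : Fin 3 => Fin 2 × Fin 2) triangleState) =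
    ∏ k, ((∑ i, ∑ j, L k i j * K (k + 1) i j) / 2) := by
  have hsq : ((Real.sqrt 2 : ℝ) : ℂ)⁻¹ ^ 3 * ((Real.sqrt 2 : ℝ) : ℂ)⁻¹ ^ 3 = 1 / 8 := by
    rw [← mul_pow, ← mul_inv, ← Complex.ofReal_mul, Real.mul_self_sqrt (by norm_num)]
    norm_num
  have hsum : Matrix.trace (tensorOp (fun _ : Fin 3 => Fin 2 × Fin 2) (fun i => K i ⊗ₖ L i) *
      outerProj (fun _ : Fin 3 => Fin 2 × Fin 2) triangleState) =
      ∑ v : Fin 3 → Fin 2 × Fin 2, (∑ w : Fin 3 → Fin 2 × Fin 2,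
        (∏ i, K i (v i).1 (w i).1 * L i (v i).2 (w i).2) * triangleState w) *
          triangleState v := by
    simp only [Matrix.trace, Matrix.diag_apply, Matrix.mul_apply, Finset.sum_mul]
    refine Fintype.sum_congr _ _ fun v => Fintype.sum_congr _ _ fun w => ?_
    rw [mul_assoc]
    conv_rhs => rw [← conj_triangleState v]
    rfl
  rw [hsum]
  simp only [sum_mul_triangleState, ← Finset.mul_sum]
  rw [← mul_assoc, hsq]
  simp only [Fin.prod_univ_three, Fin.sum_univ_two, Matrix.cons_val, Fin.reduceAdd, zero_add]
  ring

/-- The correlation of the two observables measured on an EPR pair. -/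
noncomputable def dirCorrelation (x y : Fin 2) : ℝ :=
  (secondDir x).1 * (firstDir y).1 + (secondDir x).2 * (firstDir y).2

theorem sum_effects (x y : Fin 2) (a b : Fin 4) :
    (∑ i, ∑ j, secondEffect x a i j * firstEffect y b i j) / 2 =
      (((1 + secondSign a * firstSign b * dirCorrelation x y) / 4 : ℝ) : ℂ) := by
  simp only [Fin.sum_univ_two, secondEffect, firstEffect, qubitProj, dirCorrelation,
    Matrix.of_apply, Matrix.cons_val', Matrix.cons_val_zero, Matrix.cons_val_one,
    Matrix.cons_val_fin_one]
  push_cast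
  ring

theorem bornDist_linkPOVM (a : Fin 3 → Fin 4) (x : Fin 3 → Fin 2) :
    BornDist (fun _ : Fin 3 => Fin 2 × Fin 2) (fun _ => 4) (fun _ => 2)
      (outerProj (fun _ : Fin 3 => Fin 2 × Fin 2) triangleState) (fun _ => linkPOVM) a x =
    ∏ k, (1 + secondSign (a k) * firstSign (a (k + 1)) * dirCorrelation (x k) (x (k + 1))) / 4 := by
  have h := trace_tensorOp_triangleState (fun i => firstEffect (x i) (a i))
    (fun i => secondEffect (x i) (a i))
  simp only [sum_effects, ← Complex.ofReal_prod] at h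
  exact (congrArg Complex.re h).trans (Complex.ofReal_re _)

theorem linkCorrelator_prod (C : Fin 2 → Fin 2 → ℝ) (k : Fin 3) (x y : Fin 2) :
    linkCorrelator (fun a z =>
      ∏ k, (1 + secondSign (a k) * firstSign (a (k + 1)) * C (z k) (z (k + 1))) / 4) k x y =
    C x y := by
  unfold linkCorrelator
  rw [sum_finThreeArrow]
  fin_cases k <;>
    simp [Fin.prod_univ_three, Fin.sum_univ_four, firstSign, secondSign, linkSetting] <;>
    ring

theorem sum_linkCHSH_bornDist :
    ∑ k, linkCHSH (BornDist (fun _ : Fin 3 => Fin 2 × Fin 2) (fun _ => 4) (fun _ => 2)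
      (outerProj (fun _ : Fin 3 => Fin 2 × Fin 2) triangleState) (fun _ => linkPOVM)) k =
      42 / 5 := by
  have h : BornDist (fun _ : Fin 3 => Fin 2 × Fin 2) (fun _ => 4) (fun _ => 2)
      (outerProj (fun _ : Fin 3 => Fin 2 × Fin 2) triangleState) (fun _ => linkPOVM) =
      fun a x => ∏ k, (1 + secondSign (a k) * firstSign (a (k + 1)) *
        dirCorrelation (x k) (x (k + 1))) / 4 :=
    funext fun a => funext fun x => bornDist_linkPOVM a x
  rw [h]
  simp only [linkCHSH, linkCorrelator_prod]
  norm_num [dirCorrelation, secondDir, firstDir]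

theorem ProductAcross.mul_eq {ι : Type} [Fintype ι] [DecidableEq ι] {D : ι → Type} {I : Finset ι}
    {ψ : (∀ i, D i) → ℂ} (h : ProductAcross D I ψ) (v w : ∀ i, D i) :
    ψ v * ψ w = ψ (I.piecewise v w) * ψ (I.piecewise w v) := by
  obtain ⟨φ, χ, hψ⟩ := h
  have h₁ (v w : ∀ i, D i) : restrictTo I (I.piecewise v w) = restrictTo I v :=
    funext fun i => I.piecewise_eq_of_mem _ _ i.2
  have h₂ (v w : ∀ i, D i) : restrictTo Iᶜ (I.piecewise v w) = restrictTo Iᶜ w :=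
    funext fun i => I.piecewise_eq_of_notMem _ _ (Finset.mem_compl.1 i.2)
  rw [hψ v, hψ w, hψ, hψ (I.piecewise w v), h₁, h₁, h₂, h₂]
  ring

theorem triangleState_genuinelyEntangled :
    GenuinelyEntangled (fun _ : Fin 3 => Fin 2 × Fin 2) triangleState := by
  intro I hI hI' h
  have hmul := h.mul_eq (fun _ => (0, 0)) (fun _ => (1, 1))
  have hzero : triangleState (I.piecewise (fun _ => (0, 0)) (fun _ => (1, 1))) = 0 := by
    by_cases h₀ : 0 ∈ I <;> by_cases h₁ : 1 ∈ I <;> by_cases h₂ : 2 ∈ I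
    · exact absurd (Finset.eq_univ_of_forall fun i => by fin_cases i <;> assumption) hI'
    rotate_right
    · exact absurd (Finset.eq_empty_of_forall_notMem fun i => by fin_cases i <;> assumption) hI
    all_goals simp [triangleState, eprAmp, Finset.piecewise, h₀, h₁, h₂]
  rw [hzero, zero_mul] at hmul
  simp [triangleState, eprAmp] at hmul

/-- the triangle network state is genuinely tripartite entangled, and it
is genuinely tripartite nonlocal, witnessed by local POVMs with four outcomes per
party: the resulting Born-rule distribution admits no biseparable no-signalling
decomposition. -/
theorem triangle_network_GME_and_GMN :
    GenuinelyEntangled (fun _ : Fin 3 => Fin 2 × Fin 2) triangleState ∧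
    ∃ (s : Fin 3 → ℕ)
      (M : ∀ i : Fin 3, Fin (s i) → Fin 4 → Matrix (Fin 2 × Fin 2) (Fin 2 × Fin 2) ℂ),
      (∀ i x, IsPOVM (M i x)) ∧
      ¬ BiseparableNS (fun _ : Fin 3 => Fin 4) (fun i => Fin (s i))
        (BornDist (fun _ : Fin 3 => Fin 2 × Fin 2) (fun _ => 4) s
          (outerProj (fun _ : Fin 3 => Fin 2 × Fin 2) triangleState) M) := by
  refine ⟨triangleState_genuinelyEntangled, fun _ => 2, fun _ => linkPOVM,
    fun _ => linkPOVM_isPOVM, fun h => ?_⟩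
  have hle := sum_linkCHSH_le_of_biseparableNS h
  rw [sum_linkCHSH_bornDist] at hle
  norm_num at hle
end
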